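/- arXiv:1810.12102 — 2 statements merged into one kernel-verified Lean document; each statement's English description precedes it below -/
import Mathlib

section
/- Let p > 3 be a prime and let δ ∈ {1, −1}. Then the product over all pairs 1 ≤ i < j ≤ (p−1)/2 of the Legendre symbol ((j + δi)/p) equals: (−1)^{#{k : 0 < k < p/4 and (k/p) = δ}} if p ≡ 1 (mod 4); (−1)^{(p−3)/8} if p ≡ 3 (mod 8); and (−1)^{(p+1)/8 + (h(−p)+1)/2} if p ≡ 7 (mod 8), where h(−p) is the class number of the imaginary quadratic field ℚ(√−p). -/
section
open Ideal NumberField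

section
variable {R : Type*} [CommRing R] [IsDedekindDomain R] [Module.Free ℤ R]

theorem Ideal.mul_sup_span_absNorm {m n : ℕ} {I J : Ideal R}
    (hcop : Ideal.span {(m : R)} ⊔ Ideal.span {(n : R)} = ⊤) (hI : absNorm I = m)
    (hJ : absNorm J = n) : I * J ⊔ Ideal.span {(m : R)} = I := by
  have hmI : Ideal.span {(m : R)} ≤ I := by rw [← hI]; exact span_singleton_absNorm_le I
  have hnJ : Ideal.span {(n : R)} ≤ J := by rw [← hJ]; exact span_singleton_absNorm_le J
  apply le_antisymm (sup_le Ideal.mul_le_left hmI)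
  have h1 : J ⊔ Ideal.span {(m : R)} = ⊤ := by
    rw [eq_top_iff, ← hcop, sup_comm]
    exact sup_le_sup_right hnJ _
  calc I = I * (J ⊔ Ideal.span {(m : R)}) := by rw [h1, Ideal.mul_top]
    _ = I * J ⊔ I * Ideal.span {(m : R)} := by rw [Ideal.mul_sup]
    _ ≤ _ := sup_le_sup_left Ideal.mul_le_right _

variable [Module.Finite ℤ R] in
/-- Ideals of coprime norms multiply bijectively onto the ideals whose norm is the product. -/
theorem Ideal.card_absNorm_mul_of_coprime {m n : ℕ} (hmn : m.Coprime n) (hm : m ≠ 0) (hn : n ≠ 0) :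
    Nat.card {I : Ideal R // absNorm I = m * n} =
      Nat.card {I : Ideal R // absNorm I = m} * Nat.card {I : Ideal R // absNorm I = n} := by
  rw [← Nat.card_prod]
  symm
  have hcop : Ideal.span {(m : R)} ⊔ Ideal.span {(n : R)} = ⊤ := by
    rw [← Ideal.isCoprime_iff_sup_eq, Ideal.isCoprime_span_singleton_iff]
    simpa using hmn.isCoprime.map (Int.castRingHom R)
  refine Nat.card_congr (Equiv.ofBijective
    (fun x : {I : Ideal R // absNorm I = m} × {I : Ideal R // absNorm I = n} =>
      (⟨x.1.1 * x.2.1, by rw [map_mul, x.1.2, x.2.2]⟩ : {I : Ideal R // absNorm I = m * n}))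
    ⟨?_, ?_⟩)
  · rintro ⟨⟨I, hI⟩, ⟨J, hJ⟩⟩ ⟨⟨I', hI'⟩, ⟨J', hJ'⟩⟩ h
    have h' : I * J = I' * J' := congrArg Subtype.val h
    have h1 : I = I' := by
      rw [← mul_sup_span_absNorm hcop hI hJ, h', mul_sup_span_absNorm hcop hI' hJ']
    have h2 : J = J' := by
      rw [sup_comm] at hcop
      rw [← mul_sup_span_absNorm hcop hJ hI, mul_comm, h', mul_comm,
        mul_sup_span_absNorm hcop hJ' hI']
    subst h1 h2
    rfl
  · rintro ⟨L, hL⟩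
    have hLm : (Ideal.span {(m : R)}) * Ideal.span {(n : R)} ≤ L := by
      rw [Ideal.span_singleton_mul_span_singleton, ← Nat.cast_mul, ← hL]
      exact span_singleton_absNorm_le L
    have hprod : (L ⊔ Ideal.span {(m : R)}) * (L ⊔ Ideal.span {(n : R)}) = L := by
      apply le_antisymm
      · rw [Ideal.sup_mul, Ideal.mul_sup, Ideal.mul_sup]
        exact sup_le (sup_le Ideal.mul_le_left Ideal.mul_le_left) (sup_le Ideal.mul_le_right hLm)
      · calc L = L * ⊤ := (Ideal.mul_top _).symm
          _ = L * Ideal.span {(m : R)} ⊔ L * Ideal.span {(n : R)} := by rw [← hcop, Ideal.mul_sup]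
          _ ≤ _ := by
            refine sup_le ?_ (Ideal.mul_mono le_sup_left le_sup_right)
            rw [mul_comm]
            exact Ideal.mul_mono le_sup_right le_sup_left
    have hN : absNorm (L ⊔ Ideal.span {(m : R)}) * absNorm (L ⊔ Ideal.span {(n : R)}) = m * n := by
      rw [← map_mul, hprod, hL]
    have hdvd : ∀ k : ℕ, absNorm (L ⊔ Ideal.span {(k : R)}) ∣ k ^ Module.finrank ℤ R := fun k => by
      rw [← absNorm_span_natCast]
      exact absNorm_dvd_absNorm_of_le le_sup_right
    have h1 : absNorm (L ⊔ Ideal.span {(m : R)}) ∣ m :=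
      ((hmn.pow_left _).coprime_dvd_left (hdvd m)).dvd_of_dvd_mul_right
        (by rw [← hN]; exact dvd_mul_right _ _)
    have h2 : absNorm (L ⊔ Ideal.span {(n : R)}) ∣ n :=
      ((hmn.symm.pow_left _).coprime_dvd_left (hdvd n)).dvd_of_dvd_mul_left
        (by rw [← hN]; exact dvd_mul_left _ _)
    have h1' := Nat.le_of_dvd (Nat.pos_of_ne_zero hm) h1
    have h2' := Nat.le_of_dvd (Nat.pos_of_ne_zero hn) h2
    have hm' : absNorm (L ⊔ Ideal.span {(m : R)}) = m := by
      apply le_antisymm h1'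
      have : 0 < n := Nat.pos_of_ne_zero hn
      nlinarith
    have hn' : absNorm (L ⊔ Ideal.span {(n : R)}) = n := by
      rw [hm'] at hN
      exact Nat.eq_of_mul_eq_mul_left (Nat.pos_of_ne_zero hm) hN
    exact ⟨⟨⟨_, hm'⟩, ⟨_, hn'⟩⟩, Subtype.ext hprod⟩

theorem Ideal.dvd_span_of_absNorm_eq_pow {q k : ℕ} {P I : Ideal R} [hP : P.IsPrime]
    (hI : absNorm I = q ^ k) (hPI : P ∣ I) : P ∣ Ideal.span {(q : R)} := by
  rw [Ideal.dvd_span_singleton]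
  have h : ((q ^ k : ℕ) : R) ∈ P := Ideal.le_of_dvd hPI (by rw [← hI]; exact absNorm_mem I)
  rw [Nat.cast_pow] at h
  exact hP.mem_of_pow_mem _ h
end

section
variable {R : Type*} [CommRing R] [IsDedekindDomain R] [Module.Free ℤ R]

theorem Ideal.exists_prime_dvd_of_absNorm_eq_pow_succ {q k : ℕ} (hq : q.Prime) {I : Ideal R}
    (hI : absNorm I = q ^ (k + 1)) :
    ∃ P J : Ideal R, P.IsPrime ∧ P ∣ Ideal.span {(q : R)} ∧ I = P * J ∧ absNorm P ≠ 1 := by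
  have hI1 : I ≠ ⊤ := by
    rintro rfl
    rw [absNorm_top] at hI
    exact absurd hI.symm (Nat.one_lt_pow k.succ_ne_zero hq.one_lt).ne'
  obtain ⟨P, hP, hIP⟩ := Ideal.exists_le_maximal I hI1
  have hPI := Ideal.dvd_iff_le.mpr hIP
  obtain ⟨J, hJ⟩ := hPI
  refine ⟨P, J, hP.isPrime, dvd_span_of_absNorm_eq_pow (hP := hP.isPrime) hI ⟨J, hJ⟩, hJ, ?_⟩
  rw [Ne, absNorm_eq_one_iff]
  exact hP.ne_top

theorem Ideal.eq_of_dvd_of_absNorm_eq {I J : Ideal R} (h : I ∣ J) (hN : absNorm I = absNorm J)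
    (h0 : absNorm I ≠ 0) : I = J := by
  obtain ⟨L, rfl⟩ := h
  rw [map_mul] at hN
  have : absNorm L = 1 := by
    have := hN.symm
    rwa [Nat.mul_eq_left h0] at this
  rw [absNorm_eq_one_iff.mp this, Ideal.mul_top]

variable {q : ℕ}

theorem Ideal.eq_pow_mul_pow_of_absNorm_eq_pow (hq : q.Prime) {P P' : Ideal R}
    (hP : absNorm P = q) (hP' : absNorm P' = q) (hPP' : Ideal.span {(q : R)} = P * P') (k : ℕ) :
    ∀ I : Ideal R, absNorm I = q ^ k → ∃ i ≤ k, I = P ^ i * P' ^ (k - i) := by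
  induction k with
  | zero =>
    intro I hI
    rw [pow_zero, absNorm_eq_one_iff] at hI
    exact ⟨0, le_rfl, by simp [hI]⟩
  | succ k ih =>
    intro I hI
    obtain ⟨Q, J, hQ, hQq, rfl, hQ1⟩ := exists_prime_dvd_of_absNorm_eq_pow_succ hq hI
    have hQP : Q = P ∨ Q = P' := by
      rw [hPP'] at hQq
      have hdich : ∀ {X : Ideal R}, absNorm X = q → Q ∣ X → Q = X := by
        intro X hX hQX
        refine eq_of_dvd_of_absNorm_eq hQX ?_ ?_
        · have : absNorm Q ∣ q := hX ▸ map_dvd absNorm hQX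
          rw [hX]
          exact ((Nat.dvd_prime hq).mp this).resolve_left hQ1
        · intro h0
          have := map_dvd absNorm hQX
          rw [h0, hX, zero_dvd_iff] at this
          exact hq.ne_zero this
      have hmem : P ≤ Q ∨ P' ≤ Q := hQ.mul_le.mp (Ideal.le_of_dvd hQq)
      exact hmem.imp (fun h => hdich hP (Ideal.dvd_iff_le.mpr h))
        (fun h => hdich hP' (Ideal.dvd_iff_le.mpr h))
    have hJ : absNorm J = q ^ k := by
      rw [map_mul, pow_succ'] at hI
      have : absNorm Q = q := by rcases hQP with rfl | rfl <;> assumption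
      rw [this] at hI
      exact Nat.eq_of_mul_eq_mul_left hq.pos hI
    obtain ⟨i, hi, rfl⟩ := ih J hJ
    rcases hQP with rfl | rfl
    · exact ⟨i + 1, by omega, by rw [show k + 1 - (i + 1) = k - i by omega]; ring⟩
    · exact ⟨i, by omega, by rw [show k + 1 - i = k - i + 1 by omega]; ring⟩

variable [Module.Finite ℤ R]

theorem Ideal.card_absNorm_eq_pow_of_isEmpty (hd : Module.finrank ℤ R = 2) (hq : q.Prime)
    (h : IsEmpty {I : Ideal R // absNorm I = q}) (k : ℕ) :
    Nat.card {I : Ideal R // absNorm I = q ^ k} = if Even k then 1 else 0 := by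
  have hNq : absNorm (Ideal.span {(q : R)}) = q ^ 2 := by rw [absNorm_span_natCast, hd]
  induction k using Nat.strong_induction_on with
  | _ k ih =>
    match k with
    | 0 => simp [absNorm_eq_one_iff]
    | 1 => simp
    | k + 2 =>
      have hP : ∀ I : Ideal R, absNorm I = q ^ (k + 2) → ∃ J, I = Ideal.span {(q : R)} * J := by
        intro I hI
        obtain ⟨P, J, -, hPq, rfl, hP1⟩ := exists_prime_dvd_of_absNorm_eq_pow_succ hq hI
        have hN : absNorm P ∣ q ^ 2 := hNq ▸ map_dvd absNorm hPq
        obtain ⟨m, hm, hPm⟩ := (Nat.dvd_prime_pow hq).mp hN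
        have hP2 : absNorm P = q ^ 2 := by
          interval_cases m
          · simp [hPm] at hP1
          · exact (h.false ⟨P, by simpa using hPm⟩).elim
          · exact hPm
        refine ⟨J, ?_⟩
        rw [eq_of_dvd_of_absNorm_eq hPq (hP2.trans hNq.symm)
          (by rw [hP2]; exact pow_ne_zero _ hq.ne_zero)]
      have hq0 : (Ideal.span {(q : R)}) ≠ 0 := by
        intro h0
        rw [h0, map_zero] at hNq
        exact pow_ne_zero 2 hq.ne_zero hNq.symm
      have e : Nat.card {I : Ideal R // absNorm I = q ^ k} =
          Nat.card {I : Ideal R // absNorm I = q ^ (k + 2)} := by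
        refine Nat.card_congr (Equiv.ofBijective
          (fun J => ⟨Ideal.span {(q : R)} * J.1, by rw [map_mul, hNq, J.2]; ring⟩) ⟨?_, ?_⟩)
        · intro J J' hJ
          exact Subtype.ext (mul_left_cancel₀ hq0 (congrArg Subtype.val hJ))
        · rintro ⟨I, hI⟩
          obtain ⟨J, rfl⟩ := hP I hI
          refine ⟨⟨J, ?_⟩, rfl⟩
          rw [map_mul, hNq, add_comm k 2, pow_add] at hI
          exact Nat.eq_of_mul_eq_mul_left (pow_pos hq.pos 2) hI
      rw [← e, ih k (by omega)]
      simp [Nat.even_add]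

/-- In a quadratic ring the number of ideals of norm `q` governs the number of those of norm
`q ^ k`. -/
theorem Ideal.card_absNorm_eq_prime_pow (hd : Module.finrank ℤ R = 2) (hq : q.Prime) (k : ℕ) :
    (Nat.card {I : Ideal R // absNorm I = q ^ k} : ℤ) =
      ∑ i ∈ Finset.range (k + 1), ((Nat.card {I : Ideal R // absNorm I = q} : ℤ) - 1) ^ i := by
  have hNq : absNorm (Ideal.span {(q : R)}) = q ^ 2 := by rw [absNorm_span_natCast, hd]
  rcases isEmpty_or_nonempty {I : Ideal R // absNorm I = q} with h | ⟨⟨P, hP⟩⟩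
  · rw [card_absNorm_eq_pow_of_isEmpty hd hq h, Nat.card_of_isEmpty]
    simp only [Nat.cast_zero, zero_sub, neg_one_geom_sum, Nat.even_add_one]
    split_ifs <;> simp_all
  have hPq : P ∣ Ideal.span {(q : R)} := by
    rw [Ideal.dvd_span_singleton, ← hP]
    exact absNorm_mem P
  obtain ⟨P', hPP'⟩ := hPq
  have hP' : absNorm P' = q := by
    rw [hPP', map_mul, hP, sq] at hNq
    exact Nat.eq_of_mul_eq_mul_left hq.pos hNq
  have hfac := eq_pow_mul_pow_of_absNorm_eq_pow hq hP hP' hPP'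
  have hprime : ∀ {X : Ideal R}, absNorm X = q → Prime X := fun {X} hX => by
    have := irreducible_of_irreducible_absNorm (I := X) (by rw [hX]; exact hq)
    exact this.prime
  by_cases hne : P = P'
  · subst hne
    have hone : ∀ k, Nat.card {I : Ideal R // absNorm I = q ^ k} = 1 := fun k => by
      rw [Nat.card_eq_one_iff_unique]
      refine ⟨⟨?_⟩, ⟨P ^ k, by rw [map_pow, hP]⟩⟩
      rintro ⟨I, hI⟩ ⟨J, hJ⟩
      obtain ⟨i, hi, rfl⟩ := hfac k I hI
      obtain ⟨j, hj, rfl⟩ := hfac k J hJ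
      simp only [← pow_add, Nat.add_sub_cancel' hi, Nat.add_sub_cancel' hj]
    have h1 := hone 1
    rw [pow_one] at h1
    rw [hone, h1]
    simp [Finset.sum_range_succ']
  · have hcount : ∀ k, Nat.card {I : Ideal R // absNorm I = q ^ k} = k + 1 := fun k => by
      rw [← Nat.card_fin (k + 1)]
      symm
      refine Nat.card_congr (Equiv.ofBijective (fun i : Fin (k + 1) =>
        ⟨P ^ (i : ℕ) * P' ^ (k - i), by
          rw [map_mul, map_pow, map_pow, hP, hP', ← pow_add, Nat.add_sub_cancel' (by omega)]⟩)
        ⟨?_, ?_⟩)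
      · have key : ∀ i j : ℕ, i < j → j ≤ k → P ^ i * P' ^ (k - i) ≠ P ^ j * P' ^ (k - j) := by
          intro i j hij hj h
          rw [← Nat.add_sub_cancel' hij.le, pow_add, mul_assoc] at h
          have h2 := mul_left_cancel₀ (pow_ne_zero i (hprime hP).ne_zero) h
          have h3 : P ∣ P' ^ (k - i) := by
            rw [h2]
            exact Dvd.dvd.mul_right (dvd_pow_self P (by omega)) _
          have h4 := (hprime hP).dvd_of_dvd_pow h3
          exact hne (eq_of_dvd_of_absNorm_eq h4 (hP.trans hP'.symm) (hP ▸ hq.ne_zero))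
        intro i j h
        have h' := congrArg Subtype.val h
        rcases lt_trichotomy (i : ℕ) j with hij | hij | hij
        · exact (key i j hij (by omega) h').elim
        · exact Fin.ext hij
        · exact (key j i hij (by omega) h'.symm).elim
      · rintro ⟨I, hI⟩
        obtain ⟨i, hi, rfl⟩ := hfac k I hI
        exact ⟨⟨i, by omega⟩, rfl⟩
    have h1 := hcount 1
    rw [pow_one] at h1
    rw [hcount, h1]
    simp
end

end

section
open NumberField

section ImaginaryQuadratic
variable {K : Type*} [Field K] {α : K} {p : ℕ}

theorem exists_rat_add_mul_of_mem_adjoin [Algebra ℚ K] (hα : α ^ 2 = -(p : K)) {x : K}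
    (hx : x ∈ Algebra.adjoin ℚ ({α} : Set K)) :
    ∃ a b : ℚ, x = algebraMap ℚ K a + algebraMap ℚ K b * α := by
  induction hx using Algebra.adjoin_induction with
  | mem x hx => exact ⟨0, 1, by simp [Set.mem_singleton_iff.mp hx]⟩
  | algebraMap r => exact ⟨r, 0, by simp⟩
  | add x y _ _ hx hy =>
    obtain ⟨a, b, rfl⟩ := hx
    obtain ⟨a', b', rfl⟩ := hy
    exact ⟨a + a', b + b', by simp only [map_add]; ring⟩
  | mul x y _ _ hx hy =>
    obtain ⟨a, b, rfl⟩ := hx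
    obtain ⟨a', b', rfl⟩ := hy
    refine ⟨a * a' - b * b' * p, a * b' + a' * b, ?_⟩
    simp only [map_add, map_mul, map_sub, map_natCast]
    linear_combination (algebraMap ℚ K b * algebraMap ℚ K b') * hα

theorem Complex.re_eq_zero_and_im_sq_of_sq_eq_neg {z : ℂ} (hz : z ^ 2 = -(p : ℂ)) (hp : 0 < p) :
    z.re = 0 ∧ z.im ^ 2 = p := by
  have h1 := congrArg Complex.re hz
  have h2 := congrArg Complex.im hz
  simp [sq] at h1 h2
  have hre : z.re = 0 := by
    rcases mul_eq_zero.mp (show z.re * z.im = 0 by linarith) with h | h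
    · exact h
    · rw [h] at h1
      have : (0 : ℝ) < p := by exact_mod_cast hp
      nlinarith [mul_self_nonneg z.re]
  refine ⟨hre, ?_⟩
  rw [hre] at h1
  nlinarith

theorem Rat.exists_int_of_isIntegral_complex {q : ℚ} (h : IsIntegral ℤ (q : ℂ)) :
    ∃ m : ℤ, q = m := by
  have h' : IsIntegral ℤ q := by
    rwa [show (q : ℂ) = algebraMap ℚ ℂ q from rfl,
      isIntegral_algebraMap_iff (algebraMap ℚ ℂ).injective] at h
  obtain ⟨m, hm⟩ := IsIntegrallyClosed.isIntegral_iff.mp h'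
  exact ⟨m, by simpa using hm.symm⟩

theorem Rat.exists_int_of_prime_mul_sq (hp : p.Prime) {q : ℚ} {n : ℤ} (h : p * q ^ 2 = n) :
    ∃ m : ℤ, q = m := by
  have h' : IsIntegral ℤ ((p : ℚ) * q) := by
    refine IsIntegral.of_pow (n := 2) two_pos ?_
    rw [show ((p : ℚ) * q) ^ 2 = ((p * n : ℤ) : ℚ) by push_cast; rw [← h]; ring]
    exact isIntegral_algebraMap (R := ℤ) (A := ℚ)
  obtain ⟨m, hm⟩ := IsIntegrallyClosed.isIntegral_iff.mp h'
  have hm' : (m : ℚ) = p * q := by simpa using hm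
  have h2 : m ^ 2 = p * n := by
    have : (m : ℚ) ^ 2 = p * n := by rw [hm', ← h]; ring
    exact_mod_cast this
  have h3 : (p : ℤ) ∣ m :=
    (Nat.prime_iff_prime_int.mp hp).dvd_of_dvd_pow (n := 2) ⟨n, h2⟩
  obtain ⟨k, rfl⟩ := h3
  refine ⟨k, ?_⟩
  have hp0 : (p : ℚ) ≠ 0 := by exact_mod_cast hp.ne_zero
  push_cast at hm'
  exact (mul_left_cancel₀ hp0 hm').symm

theorem exists_int_add_mul_of_isIntegral [NumberField K] (hp : p.Prime) (h4 : p % 4 = 3)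
    (hα : α ^ 2 = -(p : K)) {x : K} (hx : x ∈ Algebra.adjoin ℚ ({α} : Set K))
    (h_int : IsIntegral ℤ x) : ∃ m n : ℤ, x = m + n * ((1 + α) / 2) := by
  obtain ⟨a, b, rfl⟩ := exists_rat_add_mul_of_mem_adjoin hα hx
  obtain ⟨φ⟩ : Nonempty (K →+* ℂ) := inferInstance
  have hz : (φ α) ^ 2 = -(p : ℂ) := by rw [← map_pow, hα]; simp
  obtain ⟨hre, him⟩ := Complex.re_eq_zero_and_im_sq_of_sq_eq_neg hz hp.pos
  have hconj : (starRingEnd ℂ) (φ α) = - φ α := by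
    apply Complex.ext <;> simp [hre]
  have i1 : IsIntegral ℤ ((a : ℂ) + b * φ α) := by
    have := map_isIntegral_int φ h_int
    simpa using this
  have i2 : IsIntegral ℤ ((a : ℂ) - b * φ α) := by
    have := map_isIntegral_int (starRingEnd ℂ) i1
    simpa [hconj, sub_eq_add_neg] using this
  obtain ⟨A, hA⟩ := Rat.exists_int_of_isIntegral_complex (q := 2 * a) (by
    rw [show ((2 * a : ℚ) : ℂ) = (a + b * φ α) + (a - b * φ α) by push_cast; ring]
    exact i1.add i2)
  obtain ⟨N, hN⟩ := Rat.exists_int_of_isIntegral_complex (q := a ^ 2 + p * b ^ 2) (by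
    rw [show ((a ^ 2 + p * b ^ 2 : ℚ) : ℂ) = (a + b * φ α) * (a - b * φ α) by
      push_cast; linear_combination (b : ℂ) ^ 2 * hz]
    exact i1.mul i2)
  obtain ⟨B, hB⟩ := Rat.exists_int_of_prime_mul_sq hp (q := 2 * b) (n := 4 * N - A ^ 2) (by
    push_cast; rw [← hN, ← hA]; ring)
  have hAB : A ^ 2 + p * B ^ 2 = 4 * N := by
    have : (A : ℚ) ^ 2 + p * B ^ 2 = 4 * N := by rw [← hA, ← hB, ← hN]; ring
    exact_mod_cast this
  have h2 : (A - B) % 2 = 0 := by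
    obtain ⟨k, hk⟩ : ∃ k : ℤ, (p : ℤ) = 4 * k + 3 := ⟨p / 4, by omega⟩
    rw [hk] at hAB
    rcases Int.emod_two_eq_zero_or_one A with h | h <;>
      rcases Int.emod_two_eq_zero_or_one B with h' | h'
    · omega
    · obtain ⟨s, rfl⟩ : ∃ s, A = 2 * s := ⟨A / 2, by omega⟩
      obtain ⟨t, rfl⟩ : ∃ t, B = 2 * t + 1 := ⟨B / 2, by omega⟩
      ring_nf at hAB; omega
    · obtain ⟨s, rfl⟩ : ∃ s, A = 2 * s + 1 := ⟨A / 2, by omega⟩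
      obtain ⟨t, rfl⟩ : ∃ t, B = 2 * t := ⟨B / 2, by omega⟩
      ring_nf at hAB; omega
    · omega
  obtain ⟨m, hm⟩ : ∃ m, A = B + 2 * m := ⟨(A - B) / 2, by omega⟩
  refine ⟨m, B, ?_⟩
  have ha : (algebraMap ℚ K a) = (B + 2 * m) / 2 := by
    rw [show a = (B + 2 * m) / 2 by rw [eq_div_iff two_ne_zero, mul_comm, hA, hm]; push_cast; ring]
    simp
  have hb : (algebraMap ℚ K b) = B / 2 := by
    rw [show b = B / 2 by rw [eq_div_iff two_ne_zero, mul_comm, hB]]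
    simp
  rw [ha, hb]; ring

theorem int_add_mul_eq_zero_iff {K : Type*} [Field K] [NumberField K] {α : K} (hp : 0 < p)
    (hα : α ^ 2 = -(p : K)) {m n : ℤ} (h : (m : K) + n * ((1 + α) / 2) = 0) : m = 0 ∧ n = 0 := by
  obtain ⟨φ⟩ : Nonempty (K →+* ℂ) := inferInstance
  have hz : (φ α) ^ 2 = -(p : ℂ) := by rw [← map_pow, hα]; simp
  obtain ⟨hre, him⟩ := Complex.re_eq_zero_and_im_sq_of_sq_eq_neg hz hp
  have h0 := congrArg φ h
  simp only [map_add, map_mul, map_div₀, map_one, map_zero, map_intCast, map_ofNat] at h0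
  have h1 : ((2 * m + n : ℤ) : ℂ) + (n : ℤ) * φ α = 0 := by
    push_cast; linear_combination 2 * h0
  have h2 := congrArg Complex.im h1
  have him0 : (φ α).im ≠ 0 := by
    intro h0
    rw [h0] at him
    have : (0 : ℝ) < p := by exact_mod_cast hp
    norm_num at him
    linarith
  have hn : n = 0 := by
    rw [Complex.add_im, Complex.intCast_im, Complex.mul_im] at h2
    simpa [him0] using h2
  subst hn
  simpa using h


theorem exists_integralBasis [NumberField K] (hp : p.Prime) (h4 : p % 4 = 3)
    (hα : α ^ 2 = -(p : K)) (hK : ∀ x : K, x ∈ Algebra.adjoin ℚ ({α} : Set K)) :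
    ∃ b : Module.Basis (Fin 2) ℤ (𝓞 K), b 0 = 1 ∧ ((b 1 : 𝓞 K) : K) = (1 + α) / 2 := by
  obtain ⟨c, hc⟩ : ∃ c : ℕ, p + 1 = 4 * c := ⟨(p + 1) / 4, by omega⟩
  have hcK : (p : K) + 1 = 4 * c := by exact_mod_cast hc
  have hθ : IsIntegral ℤ ((1 + α) / 2) := by
    refine ⟨Polynomial.X ^ 2 - Polynomial.X + Polynomial.C (c : ℤ), by monicity!, ?_⟩
    simp
    linear_combination hα / 4 - hcK / 4
  obtain ⟨θ, hθ⟩ : ∃ θ : 𝓞 K, (θ : K) = (1 + α) / 2 := ⟨⟨(1 + α) / 2, hθ⟩, rfl⟩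
  have hli : LinearIndependent ℤ ![(1 : 𝓞 K), θ] := by
    rw [LinearIndependent.pair_iff]
    intro s t hst
    have := congrArg (algebraMap (𝓞 K) K) hst
    refine int_add_mul_eq_zero_iff hp.pos hα ?_
    simpa [hθ] using this
  have hsp : ⊤ ≤ Submodule.span ℤ (Set.range ![(1 : 𝓞 K), θ]) := by
    rintro x -
    obtain ⟨m, n, h⟩ := exists_int_add_mul_of_isIntegral hp h4 hα (hK x) x.isIntegral_coe
    have hx : x = m • (1 : 𝓞 K) + n • θ := by
      apply RingOfIntegers.ext
      rw [h]; simp [hθ]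
    rw [hx, Matrix.range_cons, Matrix.range_cons, Matrix.range_empty, Set.union_empty,
      Set.singleton_union]
    exact Submodule.mem_span_pair.mpr ⟨m, n, rfl⟩
  refine ⟨Module.Basis.mk hli hsp, by simp, by simp [hθ]⟩

theorem discr_of_integralBasis [NumberField K] (b : Module.Basis (Fin 2) ℤ (𝓞 K)) (h0 : b 0 = 1)
    {c : ℤ} (h1 : b 1 ^ 2 = b 1 - c) : NumberField.discr K = 1 - 4 * c := by
  rw [← NumberField.discr_eq_discr K b, Algebra.discr_def, Matrix.det_fin_two]
  have t : ∀ x, Algebra.trace ℤ (𝓞 K) x = b.repr (x * 1) 0 + b.repr (x * b 1) 1 := by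
    intro x
    rw [Algebra.trace_eq_matrix_trace b, Matrix.trace_fin_two, Algebra.leftMulMatrix_eq_repr_mul,
      Algebra.leftMulMatrix_eq_repr_mul, h0]
  have e1 : b 1 * b 1 = b 1 - c • b 0 := by rw [← sq, h1, h0]; simp
  have r1 : b.repr 1 = Finsupp.single 0 1 := by rw [← h0]; simp
  have t0 : Algebra.trace ℤ (𝓞 K) 1 = 2 := by rw [t, mul_one, one_mul, r1]; simp
  have t1 : Algebra.trace ℤ (𝓞 K) (b 1) = 1 := by rw [t, mul_one, e1]; simp [-zsmul_eq_mul]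
  have t2 : Algebra.trace ℤ (𝓞 K) (b 1 * b 1) = 1 - 2 * c := by
    rw [e1, map_sub, map_smul, h0, t0, t1, smul_eq_mul, mul_comm]
  simp only [Algebra.traceMatrix_apply, Algebra.traceForm_apply, h0, one_mul, mul_one, t0, t1, t2]
  ring

theorem not_isReal_of_sq_eq_neg (hp : 0 < p) (hα : α ^ 2 = -(p : K)) (w : InfinitePlace K) :
    ¬ w.IsReal := by
  intro h
  have := congrArg (InfinitePlace.embedding_of_isReal h) hα
  simp only [map_pow, map_neg, map_natCast] at this
  have h2 : (0 : ℝ) < p := by exact_mod_cast hp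
  nlinarith [sq_nonneg (InfinitePlace.embedding_of_isReal h α)]

theorem torsionOrder_eq_two [NumberField K] (hp : 4 < p) (hα : α ^ 2 = -(p : K))
    (h_int : ∀ x : 𝓞 K, ∃ m n : ℤ, (x : K) = m + n * ((1 + α) / 2)) :
    Units.torsionOrder K = 2 := by
  obtain ⟨φ⟩ : Nonempty (K →+* ℂ) := inferInstance
  have hz : (φ α) ^ 2 = -(p : ℂ) := by rw [← map_pow, hα]; simp
  obtain ⟨hre, him⟩ := Complex.re_eq_zero_and_im_sq_of_sq_eq_neg hz (by omega)
  have key : ∀ x ∈ Units.torsion K, x = 1 ∨ x = -1 := by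
    intro x hx
    obtain ⟨m, n, h⟩ := h_int x
    have hn1 : ‖φ (x : K)‖ = 1 := by
      rw [Units.mem_torsion] at hx
      exact hx (InfinitePlace.mk φ)
    have hn2 : Complex.normSq (φ (x : K)) = 1 := by rw [Complex.normSq_eq_norm_sq, hn1]; simp
    rw [show algebraMap (𝓞 K) K x = _ from h, Complex.normSq_apply] at hn2
    simp only [map_add, map_mul, map_div₀, map_one, map_intCast, map_ofNat] at hn2
    simp [Complex.add_re, Complex.mul_re, Complex.div_ofNat_re, hre,
      Complex.add_im, Complex.mul_im] at hn2
    have e : (2 * m + n) ^ 2 + p * n ^ 2 = 4 := by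
      have : (2 * m + n : ℝ) ^ 2 + p * n ^ 2 = 4 := by
        rw [← him]; linear_combination 4 * hn2
      exact_mod_cast this
    have hp' : (4 : ℤ) < p := by exact_mod_cast hp
    have hn0 : n = 0 := by
      by_contra hne
      have : 0 < n ^ 2 := by positivity
      nlinarith [sq_nonneg (2 * m + n)]
    subst hn0
    have hm : m ^ 2 = 1 := by linarith
    rcases mul_self_eq_one_iff.mp (sq m ▸ hm) with rfl | rfl
    · left; ext; rw [h]; simp
    · right; ext; rw [h]; simp
  have hne : (1 : (𝓞 K)ˣ) ≠ -1 := by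
    intro h
    have h' := congrArg (fun u : (𝓞 K)ˣ => ((u : 𝓞 K) : K)) h
    simp only [Units.val_one, Units.val_neg, map_one, map_neg] at h'
    have h2 : (2 : K) = 0 := by linear_combination h'
    exact two_ne_zero h2
  have hset : (Units.torsion K : Set (𝓞 K)ˣ) = {1, -1} := by
    ext x
    refine ⟨fun hx => key x hx, ?_⟩
    rintro (rfl | rfl)
    · exact one_mem _
    · rw [SetLike.mem_coe, Units.torsion, CommGroup.mem_torsion, isOfFinOrder_iff_pow_eq_one]
      exact ⟨2, two_pos, by simp⟩
  rw [Units.torsionOrder, ← Set.ncard_pair hne, ← hset]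
  rfl

theorem dedekindZeta_residue_of_sq_eq_neg [NumberField K] (hp : p.Prime) (h4 : p % 4 = 3)
    (hp3 : 3 < p) (hα : α ^ 2 = -(p : K)) (hK : ∀ x : K, x ∈ Algebra.adjoin ℚ ({α} : Set K)) :
    dedekindZeta_residue K = Real.pi * classNumber K / Real.sqrt p := by
  classical
  obtain ⟨c, hc⟩ : ∃ c : ℕ, p + 1 = 4 * c := ⟨(p + 1) / 4, by omega⟩
  have hcK : (p : K) + 1 = 4 * c := by exact_mod_cast hc
  obtain ⟨b, h0, h1⟩ := exists_integralBasis hp h4 hα hK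
  have hfin : Module.finrank ℚ K = 2 := by
    rw [← RingOfIntegers.rank, Module.finrank_eq_card_basis b, Fintype.card_fin]
  have hr : InfinitePlace.nrRealPlaces K = 0 := by
    rw [InfinitePlace.nrRealPlaces, Fintype.card_eq_zero_iff]
    exact ⟨fun w => not_isReal_of_sq_eq_neg hp.pos hα w.1 w.2⟩
  have hcx : InfinitePlace.nrComplexPlaces K = 1 := by
    have := InfinitePlace.card_add_two_mul_card_eq_rank K
    omega
  have hd : NumberField.discr K = -(p : ℤ) := by
    rw [discr_of_integralBasis b h0 (c := c)]
    · omega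
    · apply RingOfIntegers.ext
      simp only [map_pow, map_sub, h1, map_intCast]
      push_cast
      linear_combination hα / 4 - hcK / 4
  have ht : Units.torsionOrder K = 2 := by
    refine torsionOrder_eq_two (by omega) hα fun x => ?_
    exact exists_int_add_mul_of_isIntegral hp h4 hα (hK x) x.isIntegral_coe
  have hreg : Units.regulator K = 1 := by
    rw [Units.regulator_eq_det']
    have : IsEmpty {w : InfinitePlace K // w ≠ Units.dirichletUnitTheorem.w₀} := by
      rw [← Fintype.card_eq_zero_iff, Fintype.card_subtype_compl,
        InfinitePlace.card_eq_nrRealPlaces_add_nrComplexPlaces, hr, hcx]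
      simp
    rw [Matrix.det_isEmpty, abs_one]
  rw [dedekindZeta_residue_def, hr, hcx, hd, ht, hreg]
  have : |((-(p : ℤ) : ℤ) : ℝ)| = p := by simp
  rw [this]
  push_cast
  field_simp

end ImaginaryQuadratic

end

section
open Ideal

section QuadraticBasis
variable {R : Type*} [CommRing R] (b : Module.Basis (Fin 2) ℤ R) {c : ℤ}

theorem Module.Basis.eq_add_of_fin_two (h0 : b 0 = 1) (x : R) :
    x = (b.repr x 0 : R) + b.repr x 1 * b 1 := by
  conv_lhs => rw [← b.sum_repr x]
  simp [h0]

theorem Module.Basis.repr_add_mul_of_fin_two (h0 : b 0 = 1) (m n : ℤ) :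
    b.repr ((m : R) + n * b 1) 0 = m ∧ b.repr ((m : R) + n * b 1) 1 = n := by
  have : (m : R) + n * b 1 = m • b 0 + n • b 1 := by simp [h0]
  rw [this, map_add, map_smul, map_smul]
  simp

/-- The ring homomorphism from a quadratic order determined by the image of the second basis
vector. -/
noncomputable def quadraticLift (h0 : b 0 = 1) (h1 : b 1 ^ 2 = b 1 - c) {S : Type*} [CommRing S]
    (y : S) (hy : y ^ 2 = y - c) : R →+* S where
  toFun x := (b.repr x 0 : S) + b.repr x 1 * y
  map_one' := by
    have := b.repr_add_mul_of_fin_two h0 1 0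
    simp at this
    simp [this]
  map_zero' := by simp
  map_add' x x' := by simp; ring
  map_mul' x x' := by
    have hx := b.eq_add_of_fin_two h0 x
    have hx' := b.eq_add_of_fin_two h0 x'
    generalize b.repr x 0 = m at *
    generalize b.repr x 1 = n at *
    generalize b.repr x' 0 = m' at *
    generalize b.repr x' 1 = n' at *
    have e : x * x' = ((m * m' - n * n' * c : ℤ) : R) +
        ((m * n' + m' * n + n * n' : ℤ) : R) * b 1 := by
      rw [hx, hx']
      push_cast
      linear_combination (n * n' : R) * h1
    rw [e, (b.repr_add_mul_of_fin_two h0 _ _).1, (b.repr_add_mul_of_fin_two h0 _ _).2]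
    push_cast
    linear_combination -(n * n' : S) * hy

theorem quadraticLift_apply_basis (h0 : b 0 = 1) (h1 : b 1 ^ 2 = b 1 - c) {S : Type*} [CommRing S]
    (y : S) (hy : y ^ 2 = y - c) : quadraticLift b h0 h1 y hy (b 1) = y := by
  simp [quadraticLift]

theorem card_absNorm_eq_prime_of_basis [IsDedekindDomain R] [Module.Free ℤ R] (h0 : b 0 = 1)
    (h1 : b 1 ^ 2 = b 1 - c) (q : ℕ) [hq : Fact q.Prime] :
    Nat.card {I : Ideal R // absNorm I = q} = Nat.card {y : ZMod q // y ^ 2 = y - c} := by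
  symm
  have hker : ∀ f : R →+* ZMod q, absNorm (RingHom.ker f) = q := by
    intro f
    rw [absNorm_apply, Submodule.cardQuot_apply,
      Nat.card_congr (RingHom.quotientKerEquivOfSurjective (ZMod.ringHom_surjective f)).toEquiv,
      Nat.card_zmod]
  refine Nat.card_congr (Equiv.ofBijective
    (fun y => ⟨RingHom.ker (quadraticLift b h0 h1 y.1 y.2), hker _⟩) ⟨?_, ?_⟩)
  · intro y y' h
    have h' := congrArg Subtype.val h
    dsimp only at h'
    obtain ⟨k, hk⟩ := ZMod.intCast_surjective y.1
    have hmem : b 1 - (k : R) ∈ RingHom.ker (quadraticLift b h0 h1 y.1 y.2) := by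
      rw [RingHom.mem_ker, map_sub, map_intCast, quadraticLift_apply_basis, hk, sub_self]
    rw [h', RingHom.mem_ker, map_sub, map_intCast, quadraticLift_apply_basis,
      hk, sub_eq_zero] at hmem
    exact Subtype.ext hmem.symm
  · rintro ⟨I, hI⟩
    have hcard : Nat.card (R ⧸ I) = q := by
      rw [← hI, absNorm_apply, Submodule.cardQuot_apply]
    have : Finite (R ⧸ I) := Nat.finite_of_card_ne_zero (by rw [hcard]; exact hq.out.ne_zero)
    have := Fintype.ofFinite (R ⧸ I)
    let e := (ZMod.ringEquivOfPrime (R ⧸ I) hq.out (by rw [← hcard, Nat.card_eq_fintype_card])).symm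
    let f : R →+* ZMod q := e.toRingHom.comp (Ideal.Quotient.mk I)
    have hf : (f (b 1)) ^ 2 = f (b 1) - c := by rw [← map_pow, h1, map_sub, map_intCast]
    refine ⟨⟨f (b 1), hf⟩, Subtype.ext ?_⟩
    have : quadraticLift b h0 h1 (f (b 1)) hf = f := by
      ext x
      rw [b.eq_add_of_fin_two h0 x]
      simp only [map_add, map_mul, map_intCast, quadraticLift_apply_basis]
    dsimp only
    rw [this]
    ext x
    rw [RingHom.mem_ker, ← Ideal.Quotient.eq_zero_iff_mem]
    simp [f]

end QuadraticBasis

theorem card_sq_eq_sub_zmod {p : ℕ} [Fact p.Prime] (h8 : p % 8 = 7) {c : ℕ} (hc : p + 1 = 4 * c)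
    (q : ℕ) [Fact q.Prime] :
    (Nat.card {y : ZMod q // y ^ 2 = y - (c : ℤ)} : ℤ) = 1 + quadraticChar (ZMod p) q := by
  rcases eq_or_ne q 2 with rfl | hq2
  · have hc2 : ((c : ℤ) : ZMod 2) = 0 := by
      rw [ZMod.intCast_zmod_eq_zero_iff_dvd]; omega
    rw [hc2]
    have h0 (y : ZMod 2) : y ^ 2 = y - 0 := by rw [sub_zero, ZMod.pow_card]
    have h1 : Nat.card {y : ZMod 2 // y ^ 2 = y - 0} = 2 := by
      rw [Nat.card_congr (Equiv.subtypeUnivEquiv h0), Nat.card_zmod]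
    have h2 : quadraticChar (ZMod p) (2 : ℕ) = 1 := by
      have := quadraticChar_two (F := ZMod p) (by rw [ZMod.ringChar_zmod_n]; omega)
      rw [ZMod.card, ZMod.χ₈_nat_eq_if_mod_eight] at this
      push_cast
      rw [this]; simp [h8]; omega
    rw [h1, h2]; rfl
  · have h2 : (2 : ZMod q) ≠ 0 := by
      intro h
      have := (ZMod.natCast_eq_zero_iff 2 q).mp (by exact_mod_cast h)
      exact hq2 ((Nat.prime_dvd_prime_iff_eq Fact.out Nat.prime_two).mp this)
    have hring : ringChar (ZMod q) ≠ 2 := by rwa [ZMod.ringChar_zmod_n]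
    have hcq : (p : ZMod q) + 1 = 4 * c := by exact_mod_cast congrArg (Nat.cast : ℕ → ZMod q) hc
    have e : {y : ZMod q // y ^ 2 = y - (c : ℤ)} ≃
        {x : ZMod q // x ^ 2 = ((-(p : ℤ) : ℤ) : ZMod q)} :=
      { toFun := fun y => ⟨2 * y.1 - 1, by
          have := y.2
          push_cast at *
          linear_combination 4 * this + hcq⟩
        invFun := fun x => ⟨(x.1 + 1) / 2, by
          have := x.2
          push_cast at *
          field_simp
          linear_combination this - hcq⟩
        left_inv := fun y => by ext; simp; field_simp
        right_inv := fun x => by ext; simp; field_simp; ring }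
    rw [Nat.card_congr e]
    have h := quadraticChar_card_sqrts hring ((-(p : ℤ) : ℤ) : ZMod q)
    have e2 : Nat.card {x : ZMod q // x ^ 2 = ((-(p : ℤ) : ℤ) : ZMod q)} =
      ({x : ZMod q | x ^ 2 = ((-(p : ℤ) : ℤ) : ZMod q)}).toFinset.card := by
      rw [Set.toFinset_card, Nat.card_eq_fintype_card]; rfl
    rw [e2, h, add_comm]
    congr 1
    rw [← Int.cast_natCast (R := ZMod p) q]
    change legendreSym q (-(p : ℤ)) = legendreSym p (q : ℤ)
    rw [← neg_one_mul, legendreSym.mul, legendreSym.at_neg_one hq2]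
    have hp2 : p ≠ 2 := by rintro rfl; omega
    have hodd := (Fact.out : q.Prime).eq_two_or_odd.resolve_left hq2
    rcases (show q % 4 = 1 ∨ q % 4 = 3 by omega) with h4 | h4
    · rw [← legendreSym.quadratic_reciprocity_one_mod_four h4 hp2,
        ZMod.χ₄_nat_one_mod_four h4, one_mul]
    · rw [legendreSym.quadratic_reciprocity_three_mod_four (show p % 4 = 3 by omega) h4,
        ZMod.χ₄_nat_three_mod_four h4, neg_one_mul, neg_neg]

end

section
open Ideal NumberField Filter Topology
open scoped LSeries.notation

/-- The quadratic character modulo `p` as a complex Dirichlet character. -/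
noncomputable def quadraticDirichlet (p : ℕ) [Fact p.Prime] : DirichletCharacter ℂ p :=
  (quadraticChar (ZMod p)).ringHomComp (Int.castRingHom ℂ)

theorem quadraticDirichlet_apply (p : ℕ) [Fact p.Prime] (a : ZMod p) :
    quadraticDirichlet p a = (quadraticChar (ZMod p) a : ℂ) := rfl

theorem quadraticDirichlet_ne_one {p : ℕ} [Fact p.Prime] (hp : p ≠ 2) :
    quadraticDirichlet p ≠ 1 := by
  intro h
  obtain ⟨a, ha⟩ := quadraticChar_exists_neg_one' (F := ZMod p) (by rwa [ZMod.ringChar_zmod_n])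
  have h1 := congrArg (fun χ : DirichletCharacter ℂ p => χ a) h
  simp only [quadraticDirichlet_apply, ha, MulChar.one_apply_coe] at h1
  norm_num at h1

theorem card_absNorm_eq_zetaMul {R : Type*} [CommRing R] [IsDedekindDomain R] [Module.Free ℤ R]
    [Module.Finite ℤ R] (b : Module.Basis (Fin 2) ℤ R) (h0 : b 0 = 1) {p c : ℕ} [Fact p.Prime]
    (h8 : p % 8 = 7) (hc : p + 1 = 4 * c) (h1 : b 1 ^ 2 = b 1 - (c : ℤ)) {n : ℕ} (hn : n ≠ 0) :
    (Nat.card {I : Ideal R // absNorm I = n} : ℂ) = (quadraticDirichlet p).zetaMul n := by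
  let f : ArithmeticFunction ℂ :=
    ⟨fun n => if n = 0 then 0 else (Nat.card {I : Ideal R // absNorm I = n} : ℂ), by simp⟩
  have hfa (m : ℕ) (hm : m ≠ 0) : f m = Nat.card {I : Ideal R // absNorm I = m} := if_neg hm
  have hf : f.IsMultiplicative := by
    rw [ArithmeticFunction.IsMultiplicative.iff_ne_zero]
    constructor
    · have : Nat.card {I : Ideal R // absNorm I = 1} = 1 := by
        simp_rw [absNorm_eq_one_iff]
        simp
      rw [hfa 1 one_ne_zero, this, Nat.cast_one]
    · intro m n hm hn hmn
      rw [hfa _ (mul_ne_zero hm hn), hfa m hm, hfa n hn,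
        Ideal.card_absNorm_mul_of_coprime hmn hm hn, Nat.cast_mul]
  have hd : Module.finrank ℤ R = 2 := by rw [Module.finrank_eq_card_basis b, Fintype.card_fin]
  have key : f = (quadraticDirichlet p).zetaMul := by
    rw [ArithmeticFunction.IsMultiplicative.eq_iff_eq_on_prime_powers f hf _
      (DirichletCharacter.isMultiplicative_zetaMul _)]
    intro q k hq
    have : Fact q.Prime := ⟨hq⟩
    have h := Ideal.card_absNorm_eq_prime_pow (R := R) hd hq k
    rw [card_absNorm_eq_prime_of_basis b h0 h1 q, card_sq_eq_sub_zmod h8 hc q] at h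
    rw [hfa _ (pow_ne_zero k hq.ne_zero), ← Int.cast_natCast, h]
    simp only [DirichletCharacter.zetaMul, ArithmeticFunction.coe_zeta_mul_apply,
      Nat.sum_divisors_prime_pow hq]
    push_cast
    refine Finset.sum_congr rfl fun i _ => ?_
    rw [add_sub_cancel_left]
    rw [← DirichletCharacter.apply_eq_toArithmeticFunction_apply _ (pow_ne_zero i hq.ne_zero),
      Nat.cast_pow, map_pow, quadraticDirichlet_apply]
  rw [← key, hfa n hn]

theorem dedekindZeta_eq_riemannZeta_mul {K : Type*} [Field K] [NumberField K]
    (b : Module.Basis (Fin 2) ℤ (𝓞 K)) (h0 : b 0 = 1) {p c : ℕ} [Fact p.Prime]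
    (h8 : p % 8 = 7) (hc : p + 1 = 4 * c) (h1 : b 1 ^ 2 = b 1 - (c : ℤ)) {s : ℂ} (hs : 1 < s.re) :
    dedekindZeta K s = riemannZeta s * DirichletCharacter.LFunction (quadraticDirichlet p) s := by
  have h : dedekindZeta K s = LSeries (quadraticDirichlet p).zetaMul s :=
    LSeries_congr (fun hn => card_absNorm_eq_zetaMul b h0 h8 hc h1 hn) s
  rw [h, DirichletCharacter.zetaMul, ← ArithmeticFunction.coe_mul, LSeries_convolution']
  · rw [DirichletCharacter.LFunction_eq_LSeries _ hs]
    congr 1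
    · simp_rw [← ArithmeticFunction.LSeries_zeta_eq_riemannZeta hs,
        ← ArithmeticFunction.natCoe_apply]
    · exact (LSeries_congr (quadraticDirichlet p).apply_eq_toArithmeticFunction_apply s).symm
  · exact ArithmeticFunction.LSeriesSummable_zeta_iff.mpr hs
  · exact (LSeriesSummable_congr _ fun h ↦
      ((quadraticDirichlet p).apply_eq_toArithmeticFunction_apply h).symm).mpr <|
        ZMod.LSeriesSummable_of_one_lt_re (quadraticDirichlet p) hs

theorem LFunction_one_eq_dedekindZeta_residue {K : Type*} [Field K] [NumberField K]
    (b : Module.Basis (Fin 2) ℤ (𝓞 K)) (h0 : b 0 = 1) {p c : ℕ} [Fact p.Prime]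
    (h8 : p % 8 = 7) (hc : p + 1 = 4 * c) (h1 : b 1 ^ 2 = b 1 - (c : ℤ)) :
    DirichletCharacter.LFunction (quadraticDirichlet p) 1 = dedekindZeta_residue K := by
  have h := tendsto_sub_one_mul_dedekindZeta_nhdsGT K
  have hL : Continuous (DirichletCharacter.LFunction (quadraticDirichlet p)) :=
    (DirichletCharacter.differentiable_LFunction
      (quadraticDirichlet_ne_one (by rintro rfl; omega))).continuous
  have hr : Tendsto (fun s : ℝ => ((s : ℂ) - 1) * riemannZeta s *
      DirichletCharacter.LFunction (quadraticDirichlet p) s) (𝓝[>] 1)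
      (𝓝 (1 * DirichletCharacter.LFunction (quadraticDirichlet p) 1)) := by
    have ht : Tendsto (fun s : ℝ => (s : ℂ)) (𝓝[>] 1) (𝓝[≠] 1) := by
      refine tendsto_nhdsWithin_iff.mpr ⟨?_, ?_⟩
      · exact (Complex.continuous_ofReal.tendsto' 1 1 (by simp)).mono_left nhdsWithin_le_nhds
      · filter_upwards [self_mem_nhdsWithin] with s hs
        simpa using (ne_of_gt hs)
    exact (riemannZeta_residue_one.comp ht).mul
      (((hL.tendsto 1).mono_left nhdsWithin_le_nhds).comp ht)
  rw [one_mul] at hr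
  refine tendsto_nhds_unique hr (h.congr' ?_)
  filter_upwards [self_mem_nhdsWithin] with s hs
  rw [dedekindZeta_eq_riemannZeta_mul b h0 h8 hc h1 (by simpa using hs), mul_assoc]

end

section
open Filter Topology Finset

theorem sum_range_mul_eq_by_parts (a u : ℕ → ℂ) (N : ℕ) :
    ∑ n ∈ range N, a n * u n = ∑ n ∈ range N, (∑ i ∈ range (n + 1), a i) * (u n - u (n + 1)) +
      (∑ i ∈ range N, a i) * u N := by
  induction N with
  | zero => simp
  | succ N ih => rw [sum_range_succ, ih, sum_range_succ (fun n => _ * _), sum_range_succ a]; ring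

theorem rpow_neg_sub_rpow_neg_succ_le {s : ℝ} (h1 : 1 ≤ s) (h2 : s ≤ 2) (n : ℕ) :
    |((n : ℝ) + 1) ^ (-s) - ((n : ℝ) + 2) ^ (-s)| ≤ 2 * (1 / ((n : ℝ) + 1) ^ 2) := by
  have hn : (0 : ℝ) < n + 1 := by positivity
  have h12 : ((n : ℝ) + 2) ^ (-s) ≤ ((n : ℝ) + 1) ^ (-s) :=
    Real.rpow_le_rpow_of_nonpos hn (by linarith) (by linarith)
  rw [abs_of_nonneg (by linarith)]
  have hu : ((n : ℝ) + 1) ^ (-s) ≤ 1 / (n + 1) := by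
    rw [one_div, ← Real.rpow_neg_one]
    exact Real.rpow_le_rpow_of_exponent_le (by linarith [(Nat.cast_nonneg n : (0 : ℝ) ≤ n)])
      (by linarith)
  have hy : 1 - s * (1 / (n + 1)) ≤ (1 + 1 / ((n : ℝ) + 1)) ^ (-s) := by
    have hexp : (1 : ℝ) + 1 / (n + 1) ≤ Real.exp (1 / (n + 1)) := by
      linarith [Real.add_one_le_exp (1 / ((n : ℝ) + 1))]
    calc 1 - s * (1 / (n + 1)) ≤ Real.exp (-(s * (1 / (n + 1)))) := by
          linarith [Real.add_one_le_exp (-(s * (1 / ((n : ℝ) + 1))))]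
      _ = (Real.exp (1 / (n + 1))) ^ (-s) := by rw [← Real.exp_mul]; ring_nf
      _ ≤ _ := Real.rpow_le_rpow_of_nonpos (by positivity) hexp (by linarith)
  have hm : ((n : ℝ) + 2) ^ (-s) = ((n : ℝ) + 1) ^ (-s) * (1 + 1 / ((n : ℝ) + 1)) ^ (-s) := by
    rw [← Real.mul_rpow hn.le (by positivity)]
    congr 1
    field_simp; ring
  have hpos : 0 ≤ ((n : ℝ) + 1) ^ (-s) := by positivity
  have hinv : (0 : ℝ) ≤ 1 / (n + 1) := by positivity
  calc ((n : ℝ) + 1) ^ (-s) - ((n : ℝ) + 2) ^ (-s)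
      = ((n : ℝ) + 1) ^ (-s) * (1 - (1 + 1 / ((n : ℝ) + 1)) ^ (-s)) := by rw [hm]; ring
    _ ≤ ((n : ℝ) + 1) ^ (-s) * (s * (1 / (n + 1))) := by gcongr; linarith
    _ ≤ (1 / (n + 1)) * (2 * (1 / (n + 1))) := by gcongr
    _ = _ := by field_simp

theorem exists_tendsto_sum_div_and_LSeries {f : ℕ → ℂ} {M : ℝ}
    (hM : ∀ N, ‖∑ n ∈ range N, f (n + 1)‖ ≤ M)
    (hs : ∀ s : ℝ, 1 < s → LSeriesSummable f s) :
    ∃ l, Tendsto (fun N => ∑ n ∈ range N, f (n + 1) / ((n : ℂ) + 1)) atTop (𝓝 l) ∧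
      Tendsto (fun s : ℝ => LSeries f s) (𝓝[>] 1) (𝓝 l) := by
  let u : ℝ → ℕ → ℂ := fun s n => (((n : ℝ) + 1) ^ (-s) : ℝ)
  let d : ℝ → ℕ → ℂ := fun s n => (∑ i ∈ range (n + 1), f (i + 1)) * (u s n - u s (n + 1))
  have hM0 : 0 ≤ M := (norm_nonneg _).trans (hM 0)
  have hbound (s : ℝ) (h1 : 1 ≤ s) (h2 : s ≤ 2) (n : ℕ) :
      ‖d s n‖ ≤ M * (2 * (1 / ((n : ℝ) + 1) ^ 2)) := by
    rw [norm_mul]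
    refine mul_le_mul (hM _) ?_ (norm_nonneg _) hM0
    have := rpow_neg_sub_rpow_neg_succ_le h1 h2 n
    rw [← Complex.ofReal_sub, Complex.norm_real, Real.norm_eq_abs]
    push_cast
    rwa [add_assoc, one_add_one_eq_two]
  have hsum : Summable fun n : ℕ => M * (2 * (1 / ((n : ℝ) + 1) ^ 2)) := by
    refine (Summable.mul_left _ (Summable.mul_left _ ?_))
    have := (summable_nat_add_iff 1).mpr (Real.summable_one_div_nat_pow.mpr one_lt_two)
    simpa using this
  have hpart (s : ℝ) (h1 : 1 ≤ s) (h2 : s ≤ 2) :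
      Tendsto (fun N => ∑ n ∈ range N, f (n + 1) * u s n) atTop (𝓝 (∑' n, d s n)) := by
    have hd := (Summable.of_norm_bounded hsum (hbound s h1 h2)).hasSum.tendsto_sum_nat
    have h0 : Tendsto (fun N => (∑ i ∈ range N, f (i + 1)) * u s N) atTop (𝓝 0) := by
      have hu : Tendsto (fun N : ℕ => M * ((N : ℝ) + 1) ^ (-s)) atTop (𝓝 (M * 0)) := by
        refine Tendsto.const_mul _ ((tendsto_rpow_neg_atTop (by linarith)).comp ?_)
        exact tendsto_atTop_add_const_right _ _ tendsto_natCast_atTop_atTop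
      rw [mul_zero] at hu
      refine squeeze_zero_norm (fun N => ?_) hu
      rw [norm_mul, Complex.norm_real, Real.norm_eq_abs, abs_of_nonneg (by positivity)]
      exact mul_le_mul_of_nonneg_right (hM N) (by positivity)
    have := hd.add h0
    rw [add_zero] at this
    exact this.congr fun N => (sum_range_mul_eq_by_parts _ _ N).symm
  refine ⟨∑' n, d 1 n, ?_, ?_⟩
  · refine (hpart 1 le_rfl one_le_two).congr fun N => sum_congr rfl fun n _ => ?_
    simp only [u, Real.rpow_neg_one, div_eq_mul_inv]
    push_cast; rfl
  · have hT : Tendsto (fun s : ℝ => ∑' n, d s n) (𝓝[>] 1) (𝓝 (∑' n, d 1 n)) := by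
      refine tendsto_tsum_of_dominated_convergence hsum (fun n => ?_) ?_
      · have hc : Continuous fun s : ℝ => d s n := by
          have hu (m : ℕ) : Continuous fun s : ℝ => u s m := by
            refine Complex.continuous_ofReal.comp ?_
            exact Continuous.rpow continuous_const continuous_neg fun s => Or.inl (by positivity)
          exact continuous_const.mul ((hu n).sub (hu (n + 1)))
        exact (hc.tendsto 1).mono_left nhdsWithin_le_nhds
      · filter_upwards [Ioo_mem_nhdsGT (one_lt_two : (1 : ℝ) < 2)] with s hs n
        exact hbound s hs.1.le hs.2.le n
    refine hT.congr' ?_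
    filter_upwards [Ioo_mem_nhdsGT (one_lt_two : (1 : ℝ) < 2)] with s hs'
    have h1 := (hs s hs'.1).hasSum.tendsto_sum_nat.comp (tendsto_add_atTop_nat 1)
    refine tendsto_nhds_unique (hpart s hs'.1.le hs'.2.le) (h1.congr fun N => ?_)
    simp only [Function.comp]
    rw [sum_range_succ', LSeries.term_zero, add_zero]
    refine sum_congr rfl fun n _ => ?_
    rw [LSeries.term_of_ne_zero (Nat.succ_ne_zero n), div_eq_mul_inv, ← Complex.cpow_neg]
    congr 1
    simp only [u]
    rw [Complex.ofReal_cpow (by positivity)]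
    push_cast; rfl

end

section
open Filter Topology Finset

theorem Complex.one_sub_mem_slitPlane {w : ℂ} (hw : ‖w‖ = 1) (hw1 : w ≠ 1) :
    1 - w ∈ Complex.slitPlane := by
  left
  rw [Complex.sub_re, Complex.one_re, sub_pos]
  refine lt_of_le_of_ne (hw ▸ Complex.re_le_norm w) fun h => hw1 ?_
  have h2 : w.im = 0 := by
    have := Complex.normSq_eq_norm_sq w
    rw [hw, Complex.normSq_apply, h] at this
    nlinarith
  exact Complex.ext h h2

theorem tendsto_LSeries_sum_mul_pow {ι : Type*} (J : Finset ι) (c w : ι → ℂ)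
    (hw : ∀ j ∈ J, ‖w j‖ = 1) (hw1 : ∀ j ∈ J, w j ≠ 1) :
    Tendsto (fun s : ℝ => LSeries (fun n => ∑ j ∈ J, c j * w j ^ n) s) (𝓝[>] 1)
      (𝓝 (-∑ j ∈ J, c j * Complex.log (1 - w j))) := by
  set f : ℕ → ℂ := fun n => ∑ j ∈ J, c j * w j ^ n with hf
  have hM (N : ℕ) : ‖∑ n ∈ range N, f (n + 1)‖ ≤ ∑ j ∈ J, ‖c j‖ * (2 / ‖w j - 1‖) := by
    rw [hf, sum_comm]
    refine (norm_sum_le _ _).trans (sum_le_sum fun j hj => ?_)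
    rw [← mul_sum, norm_mul]
    gcongr
    simp_rw [pow_succ]
    rw [← sum_mul, geom_sum_eq (hw1 j hj), norm_mul, norm_div, hw j hj, mul_one]
    gcongr
    refine (norm_sub_le _ _).trans ?_
    rw [norm_pow, hw j hj]
    norm_num
  have hs (s : ℝ) (h : 1 < s) : LSeriesSummable f s := by
    refine LSeriesSummable_of_bounded_of_one_lt_re (m := ∑ j ∈ J, ‖c j‖) (fun n _ => ?_)
      (by simpa using h)
    refine (norm_sum_le _ _).trans (sum_le_sum fun j hj => ?_)
    rw [norm_mul, norm_pow, hw j hj, one_pow, mul_one]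
  obtain ⟨l, hl, hL⟩ := exists_tendsto_sum_div_and_LSeries hM hs
  convert hL using 2
  have hA := tendsto_map'_iff.mp (Complex.tendsto_tsum_powerSeries_nhdsWithin_lt hl)
  have hx : Tendsto (fun x : ℝ => (x : ℂ)) (𝓝[<] 1) (𝓝 1) :=
    (Complex.continuous_ofReal.tendsto' 1 1 (by simp)).mono_left nhdsWithin_le_nhds
  have h1 := hA.mul hx
  rw [mul_one] at h1
  refine tendsto_nhds_unique ?_ h1
  have h2 : Tendsto (fun x : ℝ => -∑ j ∈ J, c j * Complex.log (1 - x * w j)) (𝓝[<] 1)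
      (𝓝 (-∑ j ∈ J, c j * Complex.log (1 - w j))) := by
    refine (tendsto_finsetSum _ fun j hj => Tendsto.const_mul _ ?_).neg
    refine Tendsto.clog ?_ (Complex.one_sub_mem_slitPlane (hw j hj) (hw1 j hj))
    simpa using (hx.mul_const (w j)).const_sub 1
  refine h2.congr' ?_
  filter_upwards [Ioo_mem_nhdsLT (zero_lt_one : (0 : ℝ) < 1)] with x hx
  have hnorm (j) (hj : j ∈ J) : ‖(x : ℂ) * w j‖ < 1 := by
    rw [norm_mul, hw j hj, mul_one, Complex.norm_real, Real.norm_eq_abs, abs_of_pos hx.1]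
    exact hx.2
  have h3 (j) (hj : j ∈ J) : HasSum (fun n : ℕ => c j * (((x : ℂ) * w j) ^ (n + 1) / (n + 1)))
      (c j * -Complex.log (1 - x * w j)) := by
    have h := (hasSum_nat_add_iff' 1).mpr (Complex.hasSum_taylorSeries_neg_log (hnorm j hj))
    refine HasSum.mul_left _ ?_
    simpa using h
  have h4 := hasSum_sum h3
  simp only [mul_neg, sum_neg_distrib] at h4
  rw [← h4.tsum_eq, Function.comp, ← tsum_mul_right]
  refine tsum_congr fun n => ?_
  rw [hf, sum_div, sum_mul, sum_mul]
  exact sum_congr rfl fun j _ => by rw [mul_pow]; ring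

theorem Complex.log_one_sub_exp_mul_I {φ : ℝ} (h0 : 0 < φ) (h1 : φ < 2 * Real.pi) :
    Complex.log (1 - Complex.exp (φ * Complex.I)) =
      Real.log (2 * Real.sin (φ / 2)) + ((φ - Real.pi) / 2 : ℝ) * Complex.I := by
  have hpos : 0 < 2 * Real.sin (φ / 2) :=
    mul_pos two_pos (Real.sin_pos_of_pos_of_lt_pi (by linarith) (by linarith))
  have e : 1 - Complex.exp (φ * Complex.I) =
      ((2 * Real.sin (φ / 2) : ℝ) : ℂ) * Complex.exp (((φ - Real.pi) / 2 : ℝ) * Complex.I) := by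
    have h2 : ((φ - Real.pi) / 2 : ℝ) * Complex.I =
        (φ / 2 : ℝ) * Complex.I + (-Real.pi / 2 * Complex.I) := by push_cast; ring
    have h3 : (φ : ℂ) * Complex.I = (φ / 2 : ℝ) * Complex.I + (φ / 2 : ℝ) * Complex.I := by
      push_cast; ring
    rw [h2, h3, Complex.exp_add, Complex.exp_add, Complex.exp_neg_pi_div_two_mul_I]
    have hsin : ((2 * Real.sin (φ / 2) : ℝ) : ℂ) = 2 * Complex.sin (φ / 2 : ℝ) := by push_cast; rfl
    rw [hsin, Complex.two_sin, neg_mul, Complex.exp_neg]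
    have := Complex.exp_ne_zero ((φ / 2 : ℝ) * Complex.I)
    field_simp
    linear_combination (1 - Complex.exp ((φ / 2 : ℝ) * Complex.I) ^ 2) * Complex.I_sq
  rw [e, Complex.log_ofReal_mul hpos (Complex.exp_ne_zero _), Complex.log_exp]
  · simp; linarith [Real.pi_pos]
  · simp; linarith [Real.pi_pos]

end

section
open Filter Topology Finset

theorem ZMod.sum_eq_sum_range {M : Type*} [AddCommMonoid M] {p : ℕ} [NeZero p] (F : ZMod p → M) :
    ∑ a, F a = ∑ j ∈ range p, F j :=
  sum_nbij' (fun a => a.val) (fun j => (j : ZMod p)) (fun a _ => by simpa using a.val_lt)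
    (by simp) (by simp) (fun j hj => ZMod.val_cast_of_lt (by simpa using hj)) (by simp)

theorem ZMod.sum_eq_sum_Ico_of_map_zero {M : Type*} [AddCommMonoid M] {p : ℕ} [NeZero p]
    {F : ZMod p → M} (h0 : F 0 = 0) : ∑ a, F a = ∑ j ∈ Ico 1 p, F j := by
  rw [ZMod.sum_eq_sum_range, range_eq_Ico, ← sum_Ioo_add_eq_sum_Ico (NeZero.pos p)]
  simp only [Nat.cast_zero, h0, add_zero]
  rfl

theorem ZMod.stdAddChar_natCast {p : ℕ} [NeZero p] (j : ℕ) :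
    ZMod.stdAddChar (j : ZMod p) = Complex.exp (((2 * Real.pi * j / p : ℝ) : ℂ) * Complex.I) := by
  have := ZMod.stdAddChar_coe (N := p) (j : ℤ)
  rw [Int.cast_natCast] at this
  rw [this]
  congr 1
  push_cast; ring

section
variable {p : ℕ} [Fact p.Prime]

theorem quadraticDirichlet_zero : quadraticDirichlet p 0 = 0 := by
  simp [quadraticDirichlet_apply]

theorem quadraticDirichlet_mul_gaussSum (hp : p ≠ 2) (n : ℕ) :
    quadraticDirichlet p n * gaussSum (quadraticDirichlet p) ZMod.stdAddChar =
      ∑ j ∈ Ico 1 p, quadraticDirichlet p j * ZMod.stdAddChar (j : ZMod p) ^ n := by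
  have h (j : ZMod p) : ZMod.stdAddChar j ^ n = ZMod.stdAddChar ((n : ZMod p) * j) := by
    rw [← AddChar.map_nsmul_eq_pow, nsmul_eq_mul]
  simp_rw [h]
  rw [← ZMod.sum_eq_sum_Ico_of_map_zero
    (F := fun j => quadraticDirichlet p j * ZMod.stdAddChar ((n : ZMod p) * j))
    (by simp [quadraticDirichlet_zero])]
  by_cases hn : (n : ZMod p) = 0
  · simp [hn, quadraticDirichlet_zero, MulChar.sum_eq_zero_of_ne_one (quadraticDirichlet_ne_one hp)]
  · have hu := gaussSum_mulShift (quadraticDirichlet p) ZMod.stdAddChar (Units.mk0 _ hn)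
    rw [← hu, Units.val_mk0, ← mul_assoc, ← map_mul]
    have : quadraticDirichlet p ((n : ZMod p) * n) = 1 := by
      rw [quadraticDirichlet_apply, ← sq, quadraticChar_sq_one' hn]; simp
    rw [this, one_mul, gaussSum]
    simp [AddChar.mulShift_apply]

theorem gaussSum_mul_LFunction_one (h4 : p % 4 = 3) :
    gaussSum (quadraticDirichlet p) ZMod.stdAddChar *
      DirichletCharacter.LFunction (quadraticDirichlet p) 1 =
      -(Complex.I * Real.pi / p) * ∑ j ∈ Ico 1 p, (j : ℂ) * quadraticDirichlet p j := by
  have hp2 : p ≠ 2 := by rintro rfl; omega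
  have hp0 : (0 : ℝ) < p := by exact_mod_cast (Fact.out : p.Prime).pos
  set χ := quadraticDirichlet p with hχ
  set g := gaussSum χ ZMod.stdAddChar with hg
  have hL : Tendsto (fun s : ℝ => g * LSeries (χ ·) s) (𝓝[>] 1)
      (𝓝 (g * DirichletCharacter.LFunction χ 1)) := by
    have hc : Continuous (DirichletCharacter.LFunction χ) :=
      (DirichletCharacter.differentiable_LFunction (quadraticDirichlet_ne_one hp2)).continuous
    have ht := ((hc.comp Complex.continuous_ofReal).tendsto 1).mono_left
      (nhdsWithin_le_nhds (s := Set.Ioi 1))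
    rw [Function.comp, Complex.ofReal_one] at ht
    refine (ht.const_mul g).congr' ?_
    filter_upwards [self_mem_nhdsWithin] with s hs
    rw [Function.comp, DirichletCharacter.LFunction_eq_LSeries _ (by simpa using hs)]
  have hφ (j : ℕ) (hj : j ∈ Ico 1 p) :
      0 < 2 * Real.pi * j / p ∧ 2 * Real.pi * j / p < 2 * Real.pi := by
    rw [mem_Ico] at hj
    have h1 : (0 : ℝ) < j := by exact_mod_cast hj.1
    have h2 : (j : ℝ) < p := by exact_mod_cast hj.2
    refine ⟨by positivity, ?_⟩
    rw [div_lt_iff₀ hp0]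
    have := Real.pi_pos
    gcongr
  have hR := tendsto_LSeries_sum_mul_pow (Ico 1 p) (fun j => χ j)
    (fun j => ZMod.stdAddChar (j : ZMod p))
    (fun j _ => by rw [ZMod.stdAddChar_natCast, Complex.norm_exp_ofReal_mul_I])
    (fun j hj h => by
      rw [mem_Ico] at hj
      have := ZMod.injective_stdAddChar (h.trans (AddChar.map_zero_eq_one _).symm)
      rw [ZMod.natCast_eq_zero_iff] at this
      exact absurd (Nat.le_of_dvd hj.1 this) (by omega))
  have hlim := tendsto_nhds_unique hL (hR.congr fun s => by
    rw [← LSeries_smul]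
    refine LSeries_congr (fun {n} _ => ?_) s
    rw [← quadraticDirichlet_mul_gaussSum hp2, mul_comm]; rfl)
  rw [hlim]
  have hodd (j : ℕ) (hj : j ∈ Ico 1 p) : χ ((p - j : ℕ) : ZMod p) = - χ j := by
    rw [mem_Ico] at hj
    rw [Nat.cast_sub hj.2.le, ZMod.natCast_self, zero_sub, hχ, quadraticDirichlet_apply,
      quadraticDirichlet_apply, ← neg_one_mul, map_mul,
      quadraticChar_neg_one (by rwa [ZMod.ringChar_zmod_n]),
      ZMod.card, ZMod.χ₄_nat_three_mod_four h4]
    push_cast; ring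
  have href {F : ℕ → ℂ} : ∑ j ∈ Ico 1 p, F (p - j) = ∑ j ∈ Ico 1 p, F j :=
    sum_nbij' (fun j => p - j) (fun j => p - j) (by simp; omega) (by simp; omega)
      (by simp; omega) (by simp; omega) (by simp)
  have hzero (F : ℕ → ℂ) (hF : ∀ j ∈ Ico 1 p, F (p - j) = F j) : ∑ j ∈ Ico 1 p, χ j * F j = 0 := by
    have h := href (F := fun j => χ j * F j)
    have h' : ∑ j ∈ Ico 1 p, χ ((p - j : ℕ) : ZMod p) * F (p - j) = -∑ j ∈ Ico 1 p, χ j * F j := by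
      rw [← sum_neg_distrib]
      exact sum_congr rfl fun j hj => by rw [hodd j hj, hF j hj, neg_mul]
    rw [h'] at h
    exact self_eq_neg.mp h.symm
  have hz1 := hzero (fun j => Real.log (2 * Real.sin (2 * Real.pi * j / p / 2))) fun j hj => by
    rw [mem_Ico] at hj
    rw [Nat.cast_sub hj.2.le, ← Real.sin_pi_sub]
    congr 4
    field_simp; ring
  have hz2 := hzero (fun _ => Complex.I * Real.pi / 2) fun _ _ => rfl
  have hsum : ∑ j ∈ Ico 1 p, χ j * Complex.log (1 - ZMod.stdAddChar (j : ZMod p)) =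
      ∑ j ∈ Ico 1 p, χ j * (Real.log (2 * Real.sin (2 * Real.pi * j / p / 2)) : ℂ) -
      ∑ j ∈ Ico 1 p, χ j * (Complex.I * Real.pi / 2) +
      (Complex.I * Real.pi / p) * ∑ j ∈ Ico 1 p, (j : ℂ) * χ j := by
    rw [mul_sum, ← sum_sub_distrib, ← sum_add_distrib]
    refine sum_congr rfl fun j hj => ?_
    rw [ZMod.stdAddChar_natCast, Complex.log_one_sub_exp_mul_I (hφ j hj).1 (hφ j hj).2]
    push_cast
    have : (p : ℂ) ≠ 0 := by exact_mod_cast hp0.ne'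
    field_simp; ring
  rw [hsum, hz1, hz2]
  ring

end

end

section
open Finset Polynomial

namespace Finset

variable {M : Type*} [CommMonoid M]

@[to_additive]
theorem prod_Ico_eq_prod_double_mul_sub {n p : ℕ} (h : p = 2 * n + 1) (f : ℕ → M) :
    ∏ j ∈ Ico 1 p, f j = ∏ k ∈ Icc 1 n, f (2 * k) * f (p - 2 * k) := by
  rw [prod_mul_distrib, ← prod_filter_mul_prod_filter_not (Ico 1 p) (fun j => j % 2 = 0)]
  congr 1
  · exact (prod_nbij' (fun k => 2 * k) (fun j => j / 2) (by simp; omega) (by simp; omega)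
      (by simp) (by simp; omega) (by simp)).symm
  · exact (prod_nbij' (fun k => p - 2 * k) (fun j => (p - j) / 2) (by simp; omega) (by simp; omega)
      (by simp; omega) (by simp; omega) (by simp)).symm

@[to_additive]
theorem prod_Ico_eq_prod_mul_sub {n p : ℕ} (h : p = 2 * n + 1) (f : ℕ → M) :
    ∏ j ∈ Ico 1 p, f j = ∏ k ∈ Icc 1 n, f k * f (p - k) := by
  rw [prod_mul_distrib, ← prod_filter_mul_prod_filter_not (Ico 1 p) (fun j => j ≤ n)]
  congr 1
  · exact prod_congr (by ext; simp; omega) fun _ _ => rfl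
  · exact (prod_nbij' (fun k => p - k) (fun j => p - j) (by simp; omega) (by simp; omega)
      (by simp; omega) (by simp; omega) (by simp)).symm

end Finset

theorem ZMod.factorial_mul_factorial_mul_neg_one_pow {p : ℕ} [Fact p.Prime] (b : ℕ) :
    ∀ a : ℕ, a + b + 1 = p → (a.factorial * b.factorial : ZMod p) * (-1) ^ b = -1 := by
  induction b with
  | zero =>
    rintro a h
    have := ZMod.wilsons_lemma p
    rw [show p - 1 = a by omega] at this
    simpa using this
  | succ b ih =>
    intro a h
    have h1 := ih (a + 1) (by omega)
    rw [Nat.factorial_succ] at h1 ⊢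
    have h0 : ((a + (b + 1) + 1 : ℕ) : ZMod p) = 0 := by rw [h, ZMod.natCast_self]
    push_cast at h0 h1 ⊢
    linear_combination h1 + (-(a.factorial * b.factorial : ZMod p) * (-1) ^ b) * h0

theorem ZMod.factorial_sq_mul_neg_one_pow {p n : ℕ} [Fact p.Prime] (h : p = 2 * n + 1) :
    (n.factorial : ZMod p) ^ 2 * (-1) ^ n = -1 := by
  rw [sq, factorial_mul_factorial_mul_neg_one_pow n n (by omega)]

theorem ZMod.sum_eval_of_monic {p : ℕ} [Fact p.Prime] {f : (ZMod p)[X]} (hf : f.Monic)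
    (hd : f.natDegree = p - 1) : ∑ x : ZMod p, f.eval x = -1 := by
  have hp := (Fact.out : p.Prime)
  simp_rw [eval_eq_sum_range, hd]
  rw [sum_comm, sum_range_succ, ← mul_sum, ← hd, hf.coeff_natDegree, hd, one_mul]
  rw [sum_eq_zero, zero_add]
  · have := hp.two_le
    have h (x : ZMod p) : x ^ (p - 1) = if x = 0 then 0 else 1 := by
      split_ifs with hx
      · rw [hx, zero_pow (by omega)]
      · exact ZMod.pow_card_sub_one_eq_one hx
    simp_rw [h]
    rw [← sub_eq_zero]
    have : ∑ x : ZMod p, ((1 : ZMod p) - if x = 0 then 0 else 1) = 1 := by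
      simp [sub_ite]
    rw [sum_sub_distrib] at this
    simp only [sum_const, card_univ, ZMod.card, nsmul_eq_mul, CharP.cast_eq_zero, zero_mul] at this
    linear_combination -this
  · intro i hi
    rw [mem_range] at hi
    rw [← mul_sum, FiniteField.sum_pow_lt_card_sub_one _ _ (by rwa [ZMod.card]), mul_zero]

theorem ZMod.sum_pow_mul_choose {p n : ℕ} [Fact p.Prime] (h : p = 2 * n + 1) :
    (n.factorial : ZMod p) * ∑ j ∈ range p, (j : ZMod p) ^ n * (j.choose n : ZMod p) = -1 := by
  have hm : (X ^ n * descPochhammer (ZMod p) n).Monic :=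
    (monic_X_pow n).mul (monic_descPochhammer _ _)
  rw [← ZMod.sum_eval_of_monic hm, ZMod.sum_eq_sum_range, mul_sum]
  · refine sum_congr rfl fun j _ => ?_
    rw [eval_mul, eval_pow, eval_X, descPochhammer_eval_eq_descFactorial,
      Nat.descFactorial_eq_factorial_mul_choose]
    push_cast; ring
  · rw [Monic.natDegree_mul (monic_X_pow n) (monic_descPochhammer _ _), natDegree_X_pow,
      descPochhammer_natDegree]
    omega

theorem Polynomial.exists_X_add_one_pow_sub_pow_eq_X_mul {R : Type*} [CommRing R] (a b : ℕ) :
    ∃ r : R[X], (X + 1) ^ a - (X + 1) ^ b = X * r ∧ r.coeff 0 = a - b := by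
  obtain ⟨r, hr⟩ := X_dvd_iff.mpr (show ((X + 1) ^ a - (X + 1) ^ b : R[X]).coeff 0 = 0 by
    simp [coeff_X_add_one_pow])
  refine ⟨r, hr, ?_⟩
  rw [← coeff_X_mul, ← hr]
  simp [coeff_X_add_one_pow]

theorem Polynomial.coeff_prod_X_add_one_pow_sub_pow {R : Type*} [CommRing R] (n : ℕ)
    (a b : ℕ → ℕ) : (∏ k ∈ Icc 1 n, ((X + 1) ^ a k - (X + 1) ^ b k : R[X])).coeff n =
      ∏ k ∈ Icc 1 n, ((a k : R) - b k) := by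
  choose r hr hr0 using fun k => exists_X_add_one_pow_sub_pow_eq_X_mul (R := R) (a k) (b k)
  simp_rw [hr, prod_mul_distrib, prod_const, Nat.card_Icc, Nat.add_sub_cancel, ← hr0,
    coeff_X_pow_mul', le_refl, if_true, Nat.sub_self, coeff_zero_eq_eval_zero, eval_prod]

theorem Polynomial.coeff_comp_X_add_one_eq_zero_of_cyclotomic_dvd {p : ℕ} [Fact p.Prime]
    {f : ℤ[X]} (hf : cyclotomic p ℤ ∣ f) {n : ℕ} (hn : n < p - 1) :
    ((f.map (Int.castRingHom (ZMod p))).comp (X + 1)).coeff n = 0 := by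
  obtain ⟨q, rfl⟩ := hf
  have h := cyclotomic_mul_prime_eq_pow_of_not_dvd (ZMod p) (p := p) (n := 1)
    (fun h => (Fact.out : p.Prime).one_lt.ne' (Nat.dvd_one.mp h))
  rw [one_mul, cyclotomic_one] at h
  rw [Polynomial.map_mul, map_cyclotomic, h, mul_comp, pow_comp, sub_comp, X_comp, one_comp,
    add_sub_cancel_right, coeff_X_pow_mul', if_neg (by omega)]

section
variable {p : ℕ} [Fact p.Prime]

theorem quadraticDirichlet_natCast (j : ℕ) : quadraticDirichlet p j = (legendreSym p j : ℂ) := by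
  rw [quadraticDirichlet_apply, legendreSym]
  simp

theorem eq_neg_one_of_gaussSum_eq {n : ℕ} (h : p = 2 * n + 1) (h8 : p % 8 = 7) {ε : ℤ}
    {ζ : ℂ} (hζ : IsPrimitiveRoot ζ p)
    (hg : ∑ j ∈ Ico 1 p, (legendreSym p j : ℂ) * ζ ^ j = ε * ∏ k ∈ Icc 1 n, (ζ ^ k - ζ ^ (p - k))) :
    (ε : ZMod p) = -1 := by
  have hp := (Fact.out : p.Prime)
  set f : ℤ[X] := ∑ j ∈ Ico 1 p, C (legendreSym p j) * X ^ j -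
    C ε * ∏ k ∈ Icc 1 n, (X ^ k - X ^ (p - k)) with hf
  have hd : cyclotomic p ℤ ∣ f := by
    rw [cyclotomic_eq_minpoly hζ hp.pos]
    refine minpoly.isIntegrallyClosed_dvd (hζ.isIntegral hp.pos) ?_
    simp [hf, hg]
  have h0 := coeff_comp_X_add_one_eq_zero_of_cyclotomic_dvd hd (n := n) (by omega)
  have hcomp : (f.map (Int.castRingHom (ZMod p))).comp (X + 1) =
      ∑ j ∈ range p, C ((j : ZMod p) ^ n) * (X + 1) ^ j -
      C (ε : ZMod p) * ∏ k ∈ Icc 1 n, ((X + 1) ^ k - (X + 1) ^ (p - k)) := by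
    have hn : n ≠ 0 := by omega
    have hl (j : ℕ) : ((legendreSym p j : ℤ) : (ZMod p)[X]) = (j : (ZMod p)[X]) ^ n := by
      have := congrArg C (legendreSym.eq_pow p j)
      simpa [show p / 2 = n by omega] using this
    rw [range_eq_Ico, ← sum_Ioo_add_eq_sum_Ico hp.pos]
    simp [hf, Polynomial.map_sum, Polynomial.map_prod, Polynomial.prod_comp, hl, hn]
    rfl
  rw [hcomp, coeff_sub, coeff_C_mul, coeff_prod_X_add_one_pow_sub_pow, finsetSum_coeff] at h0
  simp_rw [coeff_C_mul, coeff_X_add_one_pow] at h0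
  have h1 := ZMod.sum_pow_mul_choose h
  have h2 := ZMod.factorial_sq_mul_neg_one_pow h
  have h3 : (2 : ZMod p) ^ n = 1 := by
    have := legendreSym.eq_pow p 2
    rw [legendreSym.at_two (by omega), ZMod.χ₈_nat_eq_if_mod_eight, h8,
      show p / 2 = n by omega] at this
    simpa [show p % 2 = 1 by omega] using this.symm
  have h4 : ∏ k ∈ Icc 1 n, (((k : ℕ) : ZMod p) - ((p - k : ℕ) : ZMod p)) = n.factorial := by
    have h5 (k : ℕ) (hk : k ∈ Icc 1 n) : (k : ZMod p) - ((p - k : ℕ) : ZMod p) = 2 * k := by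
      rw [mem_Icc] at hk
      rw [Nat.cast_sub (by omega), ZMod.natCast_self]; ring
    rw [prod_congr rfl h5]
    rw [prod_mul_distrib, prod_const, Nat.card_Icc, Nat.add_sub_cancel, h3, one_mul,
      ← Finset.prod_Ico_id_eq_factorial]
    push_cast; rfl
  rw [h4] at h0
  rw [Odd.neg_one_pow (by rw [Nat.odd_iff]; omega)] at h2
  linear_combination h1 - (n.factorial : ZMod p) * h0 + (ε : ZMod p) * h2

omit [Fact p.Prime] in
theorem IsPrimitiveRoot.prod_pow_sub_pow_sq {n : ℕ} (h : p = 2 * n + 1) {ζ : ℂ}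
    (hζ : IsPrimitiveRoot ζ p) :
    (∏ k ∈ Icc 1 n, (ζ ^ k - ζ ^ (p - k))) ^ 2 = (-1) ^ n * p := by
  have h1 := (h ▸ hζ : IsPrimitiveRoot ζ (2 * n + 1)).prod_one_sub_pow_eq_order
  have h2 : ∏ j ∈ Ico 1 p, (1 - ζ ^ j) = p := by
    rw [prod_Ico_eq_prod_range, h]
    push_cast
    simpa [add_comm] using h1
  rw [← h2, prod_Ico_eq_prod_double_mul_sub h, ← prod_pow]
  have h3 : ((-1 : ℂ)) ^ n = ∏ k ∈ Icc 1 n, -1 := by simp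
  rw [h3, ← prod_mul_distrib]
  refine prod_congr rfl fun k hk => ?_
  rw [mem_Icc] at hk
  obtain ⟨m, hm⟩ : ∃ m, p = 2 * k + m := ⟨p - 2 * k, by omega⟩
  have h4 := hζ.pow_eq_one
  rw [hm] at h4
  rw [show p - k = k + m by omega, show p - 2 * k = m by omega]
  ring_nf at h4 ⊢
  linear_combination (ζ ^ m - 1) * h4


omit [Fact p.Prime] in
theorem prod_sin_two_pi_pos {n : ℕ} (h : p = 2 * n + 1) :
    0 < ∏ k ∈ Icc 1 n, Real.sin (2 * Real.pi * k / p) := by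
  refine prod_pos fun k hk => Real.sin_pos_of_pos_of_lt_pi ?_ ?_
  · rw [mem_Icc] at hk
    have h1 : (0 : ℝ) < k := by exact_mod_cast hk.1
    have h2 : (0 : ℝ) < p := by exact_mod_cast (by omega : 0 < p)
    positivity
  · rw [mem_Icc] at hk
    have h2 : (0 : ℝ) < p := by exact_mod_cast (by omega : 0 < p)
    have h1 : (2 * k : ℝ) < p := by exact_mod_cast (by omega : 2 * k < p)
    rw [div_lt_iff₀ h2]
    nlinarith [Real.pi_pos]

theorem stdAddChar_one_pow (j : ℕ) :
    (ZMod.stdAddChar (1 : ZMod p) : ℂ) ^ j = ZMod.stdAddChar (j : ZMod p) := by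
  rw [← AddChar.map_nsmul_eq_pow, nsmul_one]

theorem stdAddChar_one_pow_sub_pow {k : ℕ} (hk : k ≤ p) :
    (ZMod.stdAddChar (1 : ZMod p) : ℂ) ^ k - ZMod.stdAddChar (1 : ZMod p) ^ (p - k) =
      2 * Complex.I * (Real.sin (2 * Real.pi * k / p) : ℝ) := by
  rw [stdAddChar_one_pow, stdAddChar_one_pow, Nat.cast_sub hk, ZMod.natCast_self, zero_sub,
    AddChar.map_neg_eq_inv, ZMod.stdAddChar_natCast, ← Complex.exp_neg, ← neg_mul,
    Complex.exp_mul_I,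
    Complex.exp_mul_I, Complex.cos_neg, Complex.sin_neg, ← Complex.ofReal_sin]
  ring

theorem isPrimitiveRoot_stdAddChar_one : IsPrimitiveRoot (ZMod.stdAddChar (1 : ZMod p) : ℂ) p := by
  have := Complex.isPrimitiveRoot_exp p (Fact.out : p.Prime).ne_zero
  convert this using 1
  have h := ZMod.stdAddChar_natCast (p := p) 1
  rw [Nat.cast_one] at h
  rw [h]
  congr 1
  push_cast; ring

theorem gaussSum_quadraticDirichlet_of_seven (h8 : p % 8 = 7) :
    gaussSum (quadraticDirichlet p) ZMod.stdAddChar = Complex.I * Real.sqrt p := by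
  have hp2 : p ≠ 2 := by rintro rfl; omega
  obtain ⟨n, hn⟩ : ∃ n, p = 2 * n + 1 := ⟨p / 2, by omega⟩
  set ζ : ℂ := ZMod.stdAddChar (1 : ZMod p) with hζ
  have hprim : IsPrimitiveRoot ζ p := isPrimitiveRoot_stdAddChar_one
  set P : ℂ := ∏ k ∈ Icc 1 n, (ζ ^ k - ζ ^ (p - k)) with hP
  have hodd : Odd n := by rw [Nat.odd_iff]; omega
  have hP2 : P ^ 2 = -p := by
    rw [hP, IsPrimitiveRoot.prod_pow_sub_pow_sq hn hprim, hodd.neg_one_pow, neg_one_mul]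
  set R : ℝ := 2 ^ n * ∏ k ∈ Icc 1 n, Real.sin (2 * Real.pi * k / p) with hR
  have hRpos : 0 < R := mul_pos (by positivity) (prod_sin_two_pi_pos hn)
  have hPR : P = -Complex.I * R := by
    rw [hP, prod_congr rfl fun k hk => stdAddChar_one_pow_sub_pow (p := p) (k := k)
      (by rw [mem_Icc] at hk; omega), prod_mul_distrib, prod_const, Nat.card_Icc,
      Nat.add_sub_cancel, mul_pow, Complex.I_pow_eq_pow_mod, show n % 4 = 3 by omega,
      Complex.I_pow_three, hR]
    push_cast; ring
  have hRp : R = Real.sqrt p := by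
    refine ((Real.sqrt_eq_iff_mul_self_eq_of_pos hRpos).mpr ?_).symm
    rw [hPR] at hP2
    have : ((R * R : ℝ) : ℂ) = ((p : ℝ) : ℂ) := by
      push_cast
      linear_combination -hP2 + (R : ℂ) ^ 2 * Complex.I_sq
    exact_mod_cast this
  have hg : gaussSum (quadraticDirichlet p) ZMod.stdAddChar =
      ∑ j ∈ Ico 1 p, (legendreSym p j : ℂ) * ζ ^ j := by
    rw [gaussSum, ZMod.sum_eq_sum_Ico_of_map_zero (by simp [quadraticDirichlet_zero])]
    exact sum_congr rfl fun j _ => by rw [quadraticDirichlet_natCast, hζ, stdAddChar_one_pow]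
  have hg2 : gaussSum (quadraticDirichlet p) ZMod.stdAddChar ^ 2 = -p := by
    have hq : (quadraticDirichlet p).IsQuadratic := (quadraticChar_isQuadratic (ZMod p)).comp _
    refine (gaussSum_sq (χ := quadraticDirichlet p) (quadraticDirichlet_ne_one hp2) hq
      (ZMod.isPrimitive_stdAddChar p)).trans ?_
    rw [quadraticDirichlet_apply, quadraticChar_neg_one (by rwa [ZMod.ringChar_zmod_n]),
      ZMod.card, ZMod.χ₄_nat_three_mod_four (by omega)]
    simp
  rcases sq_eq_sq_iff_eq_or_eq_neg.mp (hg2.trans hP2.symm) with h | h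
  · exfalso
    have := eq_neg_one_of_gaussSum_eq (p := p) hn h8 (ε := 1) hprim (by rw [← hg, h]; simp [hP])
    have h2 : ((2 : ℕ) : ZMod p) = 0 := by
      push_cast at this ⊢; linear_combination this
    rw [ZMod.natCast_eq_zero_iff] at h2
    have := Nat.le_of_dvd (by norm_num) h2
    omega
  · rw [h, hPR, hRp]; ring

end

end

section
open Finset

section
variable {p : ℕ} [Fact p.Prime]

theorem legendreSym_eq_one_or_neg_one_of_mem {k : ℕ} (hk : k ∈ Ico 1 p) :
    legendreSym p k = 1 ∨ legendreSym p k = -1 := by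
  rw [mem_Ico] at hk
  refine legendreSym.eq_one_or_neg_one p fun h => ?_
  rw [Int.cast_natCast, ZMod.natCast_eq_zero_iff] at h
  exact absurd (Nat.le_of_dvd hk.1 h) (by omega)

theorem legendreSym_prod (s : Finset ℕ) (f : ℕ → ℤ) :
    legendreSym p (∏ k ∈ s, f k) = ∏ k ∈ s, legendreSym p (f k) :=
  map_prod (legendreSym.hom p) f s

theorem legendreSym_factorial (m : ℕ) :
    legendreSym p (m.factorial : ℕ) = ∏ k ∈ Icc 1 m, legendreSym p k := by
  rw [← prod_Ico_id_eq_factorial, Nat.cast_prod, legendreSym_prod]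
  rfl

theorem legendreSym_factorial_sq {m : ℕ} (hm : m < p) :
    legendreSym p (m.factorial : ℕ) ^ 2 = 1 := by
  refine legendreSym.sq_one p ?_
  rw [Int.cast_natCast, Ne, ZMod.natCast_eq_zero_iff, (Fact.out : p.Prime).dvd_factorial]
  omega

theorem legendreSym_sub_of_three_mod_four (h4 : p % 4 = 3) {k : ℕ} (hk : k ≤ p) :
    legendreSym p (p - k : ℕ) = -legendreSym p k := by
  have h : legendreSym p (-1) = -1 := by
    rw [legendreSym.at_neg_one (by omega), ZMod.χ₄_nat_three_mod_four h4]
  rw [legendreSym, Int.cast_natCast, Nat.cast_sub hk, ZMod.natCast_self, zero_sub,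
    ← neg_one_mul (legendreSym p k), ← h, ← legendreSym.mul, legendreSym]
  push_cast; ring_nf

theorem sum_legendreSym_half (h4 : p % 4 = 3) {m : ℕ} (hm : p = 4 * m + 3) :
    ∑ k ∈ Icc 1 (2 * m + 1), legendreSym p k = legendreSym p 2 *
      (∑ k ∈ Icc 1 m, legendreSym p k - ∑ k ∈ Ioc m (2 * m + 1), legendreSym p k) := by
  rw [mul_sub, mul_sum, mul_sum, sub_eq_add_neg, ← sum_neg_distrib,
    ← sum_filter_add_sum_filter_not (Icc 1 (2 * m + 1)) (fun j => j % 2 = 0)]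
  congr 1
  · refine (sum_nbij' (fun k => 2 * k) (fun j => j / 2) (by simp; omega) (by simp; omega)
      (by simp) (by simp; omega) fun k _ => ?_).symm
    rw [← legendreSym.mul]; push_cast; rfl
  · refine (sum_nbij' (fun k => p - 2 * k) (fun j => (p - j) / 2) (by simp; omega)
      (by simp; omega) (by simp; omega) (by simp; omega) fun k hk => ?_).symm
    rw [mem_Ioc] at hk
    rw [legendreSym_sub_of_three_mod_four h4 (by omega), ← legendreSym.mul]; push_cast; rfl

theorem sum_Icc_add_sum_Ioc (m : ℕ) :
    ∑ k ∈ Icc 1 (2 * m + 1), legendreSym p k =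
      ∑ k ∈ Icc 1 m, legendreSym p k + ∑ k ∈ Ioc m (2 * m + 1), legendreSym p k := by
  rw [← sum_union]
  · congr 1; ext; simp; omega
  · rw [disjoint_left]; intro; simp; omega

theorem legendreSym_two_of_three (h8 : p % 8 = 3) : legendreSym p 2 = -1 := by
  rw [legendreSym.at_two (by omega), ZMod.χ₈_nat_eq_if_mod_eight, h8]
  simp [show p % 2 = 1 by omega]

theorem legendreSym_two_of_seven (h8 : p % 8 = 7) : legendreSym p 2 = 1 := by
  rw [legendreSym.at_two (by omega), ZMod.χ₈_nat_eq_if_mod_eight, h8]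
  simp [show p % 2 = 1 by omega]

theorem sum_legendreSym_quarter_of_three (h8 : p % 8 = 3) {m : ℕ} (hm : p = 4 * m + 3) :
    ∑ k ∈ Icc 1 m, legendreSym p k = 0 := by
  have h1 := sum_legendreSym_half (by omega) hm
  rw [sum_Icc_add_sum_Ioc, legendreSym_two_of_three h8] at h1
  linarith

theorem sum_legendreSym_quarter_of_seven (h8 : p % 8 = 7) {m : ℕ} (hm : p = 4 * m + 3) :
    ∑ k ∈ Icc 1 m, legendreSym p k = ∑ k ∈ Icc 1 (2 * m + 1), legendreSym p k := by
  have h1 := sum_legendreSym_half (by omega) hm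
  rw [sum_Icc_add_sum_Ioc, legendreSym_two_of_seven h8] at h1
  rw [sum_Icc_add_sum_Ioc]
  linarith

theorem sum_mul_legendreSym_of_seven (h8 : p % 8 = 7) {n : ℕ} (hn : p = 2 * n + 1) :
    ∑ j ∈ Ico 1 p, (j : ℤ) * legendreSym p j = -p * ∑ k ∈ Icc 1 n, legendreSym p k := by
  have h1 := sum_Ico_eq_sum_add_sub hn fun j => (j : ℤ) * legendreSym p j
  have h2 := sum_Ico_eq_sum_double_add_sub hn fun j => (j : ℤ) * legendreSym p j
  have h3 : ∑ k ∈ Icc 1 n, ((k : ℤ) * legendreSym p k + (p - k : ℕ) * legendreSym p (p - k : ℕ)) =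
      2 * ∑ k ∈ Icc 1 n, (k : ℤ) * legendreSym p k - p * ∑ k ∈ Icc 1 n, legendreSym p k := by
    rw [mul_sum, mul_sum, ← sum_sub_distrib]
    refine sum_congr rfl fun k hk => ?_
    rw [mem_Icc] at hk
    rw [legendreSym_sub_of_three_mod_four (by omega) (by omega), Nat.cast_sub (by omega)]
    ring
  have h4 : ∑ k ∈ Icc 1 n, (((2 * k : ℕ) : ℤ) * legendreSym p (2 * k : ℕ) +
      (p - 2 * k : ℕ) * legendreSym p (p - 2 * k : ℕ)) =
      4 * ∑ k ∈ Icc 1 n, (k : ℤ) * legendreSym p k - p * ∑ k ∈ Icc 1 n, legendreSym p k := by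
    rw [mul_sum, mul_sum, ← sum_sub_distrib]
    refine sum_congr rfl fun k hk => ?_
    rw [mem_Icc] at hk
    rw [legendreSym_sub_of_three_mod_four (by omega) (by omega), Nat.cast_sub (by omega),
      Nat.cast_mul, legendreSym.mul, Nat.cast_two, legendreSym_two_of_seven h8]
    ring
  linarith

theorem classNumber_eq_sum_legendreSym (h8 : p % 8 = 7) {n : ℕ} (hn : p = 2 * n + 1)
    {K : Type*} [Field K] [NumberField K] {α : K} (hα : α ^ 2 = -(p : K))
    (hK : ∀ x : K, x ∈ Algebra.adjoin ℚ ({α} : Set K)) :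
    (NumberField.classNumber K : ℤ) = ∑ k ∈ Icc 1 n, legendreSym p k := by
  have hp := (Fact.out : p.Prime)
  obtain ⟨b, h0, h1⟩ := exists_integralBasis hp (by omega) hα hK
  obtain ⟨c, hc⟩ : ∃ c, p + 1 = 4 * c := ⟨(p + 1) / 4, by omega⟩
  have hb : b 1 ^ 2 = b 1 - (c : ℤ) := by
    have hcK : (p : K) + 1 = 4 * c := by exact_mod_cast congrArg (Nat.cast : ℕ → K) hc
    apply NumberField.RingOfIntegers.ext
    simp only [map_pow, map_sub, h1, map_intCast]
    push_cast
    linear_combination hα / 4 - hcK / 4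
  have hL := LFunction_one_eq_dedekindZeta_residue b h0 h8 hc hb
  rw [dedekindZeta_residue_of_sq_eq_neg hp (by omega) (by omega) hα hK] at hL
  have hG := gaussSum_mul_LFunction_one (p := p) (by omega)
  rw [gaussSum_quadraticDirichlet_of_seven h8, hL] at hG
  have hS := congrArg (Int.cast : ℤ → ℂ) (sum_mul_legendreSym_of_seven h8 hn)
  push_cast at hS
  simp_rw [quadraticDirichlet_natCast] at hG
  rw [hS] at hG
  have hp0 : (p : ℂ) ≠ 0 := by exact_mod_cast hp.ne_zero
  have hs0 : ((Real.sqrt p : ℝ) : ℂ) ≠ 0 := by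
    exact_mod_cast (Real.sqrt_pos.mpr (by exact_mod_cast hp.pos)).ne'
  have hpi : ((Real.pi : ℝ) : ℂ) ≠ 0 := by exact_mod_cast Real.pi_ne_zero
  push_cast at hG
  field_simp at hG
  exact_mod_cast hG

end

end

section
open Finset

theorem Finset.prod_range_eq_one_of_reflect {f : ℕ → ℤ} {n c : ℕ} (hc : n = 2 * c)
    (hr : ∀ j < n, f (n - 1 - j) = f j) (hf : ∀ j < n, f j ^ 2 = 1) : ∏ j ∈ range n, f j = 1 := by
  refine prod_involution (fun j _ => n - 1 - j) ?_ ?_ ?_ ?_ <;> simp only [mem_range]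
  · intro j hj
    rw [hr j hj, ← sq, hf j hj]
  all_goals omega

theorem Finset.prod_range_eq_mid_of_reflect {f : ℕ → ℤ} {n c : ℕ} (hc : n = 2 * c + 1)
    (hr : ∀ j < n, f (n - 1 - j) = f j) (hf : ∀ j < n, f j ^ 2 = 1) :
    ∏ j ∈ range n, f j = f c := by
  rw [← mul_prod_erase (range n) f (show c ∈ range n by simp; omega)]
  conv_rhs => rw [← mul_one (f c)]
  congr 1
  refine prod_involution (fun j _ => n - 1 - j) ?_ ?_ ?_ ?_ <;> simp only [mem_range, mem_erase]
  · intro j hj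
    rw [hr j hj.2, ← sq, hf j hj.2]
  all_goals omega

theorem Finset.prod_eq_neg_one_pow_card_filter {s : Finset ℕ} {f : ℕ → ℤ}
    (hf : ∀ k ∈ s, f k = 1 ∨ f k = -1) : ∏ k ∈ s, f k = (-1) ^ #{k ∈ s | f k = -1} := by
  rw [prod_filter_mul_prod_filter_not s (fun k => f k = -1) f |>.symm,
    prod_congr rfl fun k hk => (mem_filter.mp hk).2, prod_const,
    prod_eq_one (s := {k ∈ s | ¬ f k = -1}) fun k hk => ?_, mul_one]
  rw [mem_filter] at hk
  exact (hf k hk.1).resolve_right hk.2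

theorem Finset.sum_eq_card_sub_two_mul_card_filter {s : Finset ℕ} {f : ℕ → ℤ}
    (hf : ∀ k ∈ s, f k = 1 ∨ f k = -1) :
    ∑ k ∈ s, f k = #s - 2 * #{k ∈ s | f k = -1} := by
  rw [card_eq_sum_ones, card_filter]
  push_cast
  rw [mul_sum, ← sum_sub_distrib]
  refine sum_congr rfl fun k hk => ?_
  rcases hf k hk with h | h <;> simp [h]

section
variable {p : ℕ} [Fact p.Prime]

theorem prod_range_legendreSym_factorial {m : ℕ} (hm : 2 * m < p) :
    (∏ j ∈ range (2 * m), legendreSym p (j.factorial : ℕ)) *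
      legendreSym p ((2 * m).factorial : ℕ) =
      legendreSym p 2 ^ m * legendreSym p (m.factorial : ℕ) := by
  induction m with
  | zero => simp
  | succ m ih =>
    have h1 := legendreSym_factorial_sq (p := p) (m := 2 * m + 1) (by omega)
    have h2 : legendreSym p ((2 * (m + 1)).factorial : ℕ) =
        legendreSym p 2 * legendreSym p (m + 1) * legendreSym p ((2 * m + 1).factorial : ℕ) := by
      rw [show 2 * (m + 1) = 2 * m + 1 + 1 by ring, Nat.factorial_succ, Nat.cast_mul,
        legendreSym.mul, ← legendreSym.mul p 2]
      congr 2
    have h3 : legendreSym p ((m + 1).factorial : ℕ) =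
        legendreSym p (m + 1) * legendreSym p (m.factorial : ℕ) := by
      rw [Nat.factorial_succ, Nat.cast_mul, legendreSym.mul, Nat.cast_succ]
    rw [h2, h3, show 2 * (m + 1) = 2 * m + 1 + 1 by ring, prod_range_succ, prod_range_succ,
      pow_succ]
    have h4 := ih (by omega)
    linear_combination (legendreSym p 2 ^ m * legendreSym p (m.factorial : ℕ) *
      legendreSym p 2 * legendreSym p (m + 1)) * h1 + legendreSym p 2 * legendreSym p (m + 1) *
      legendreSym p ((2 * m + 1).factorial : ℕ) ^ 2 * h4

theorem prod_legendreSym_sub (n : ℕ) :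
    ∏ j ∈ Icc 1 n, ∏ i ∈ Ico 1 j, legendreSym p ((j : ℤ) + -1 * (i : ℤ)) =
      ∏ j ∈ range n, legendreSym p (j.factorial : ℕ) := by
  rw [show Icc 1 n = Ico 1 (n + 1) from rfl, prod_Ico_eq_prod_range, Nat.add_sub_cancel]
  refine prod_congr rfl fun j _ => ?_
  rw [legendreSym_factorial]
  refine prod_nbij' (fun i => 1 + j - i) (fun i => 1 + j - i) (by simp; omega) (by simp; omega)
    (by simp; omega) (by simp; omega) fun i hi => ?_
  rw [mem_Ico] at hi
  rw [Nat.cast_sub (by omega)]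
  ring_nf

theorem prod_legendreSym_add_mul (n : ℕ) :
    (∏ j ∈ Icc 1 n, ∏ i ∈ Ico 1 j, legendreSym p ((j : ℤ) + 1 * (i : ℤ))) *
      ((∏ j ∈ range n, legendreSym p (j.factorial : ℕ)) * legendreSym p (n.factorial : ℕ)) =
      ∏ j ∈ range n, legendreSym p ((2 * j + 1).factorial : ℕ) := by
  rw [← prod_range_succ (fun j => legendreSym p (j.factorial : ℕ)), prod_range_succ',
    show Icc 1 n = Ico 1 (n + 1) from rfl, prod_Ico_eq_prod_range, Nat.add_sub_cancel,
    Nat.factorial_zero, Nat.cast_one, legendreSym.at_one, mul_one, ← prod_mul_distrib]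
  refine prod_congr rfl fun j _ => ?_
  have hj : (2 * j + 1).factorial = (j + 1).factorial * ∏ i ∈ range j, (j + 1 + 1 + i) := by
    rw [← Nat.ascFactorial_eq_prod_range, Nat.factorial_mul_ascFactorial]
    congr 1; ring
  rw [hj, Nat.cast_mul, legendreSym.mul, Nat.cast_prod, legendreSym_prod, mul_comm,
    prod_Ico_eq_prod_range, show 1 + j - 1 = j by omega]
  congr 1
  refine prod_congr rfl fun i _ => ?_
  push_cast; ring_nf

theorem legendreSym_factorial_odd_reflect {n j : ℕ} (hn : p = 2 * n + 1) (hj : j < n) :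
    legendreSym p ((2 * (n - 1 - j) + 1).factorial : ℕ) =
      legendreSym p ((2 * j + 1).factorial : ℕ) := by
  have h := ZMod.factorial_mul_factorial_mul_neg_one_pow (p := p) (2 * j + 1)
    (2 * (n - 1 - j) + 1) (by omega)
  rw [Odd.neg_one_pow (by simp)] at h
  have h1 : legendreSym p ((2 * (n - 1 - j) + 1).factorial : ℕ) *
      legendreSym p ((2 * j + 1).factorial : ℕ) = 1 := by
    rw [← legendreSym.mul, ← legendreSym.at_one (p := p), legendreSym, legendreSym]
    congr 1
    push_cast
    linear_combination -h
  have h2 := legendreSym_factorial_sq (p := p) (m := 2 * j + 1) (by omega)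
  linear_combination legendreSym p ((2 * j + 1).factorial : ℕ) * h1 -
    legendreSym p ((2 * (n - 1 - j) + 1).factorial : ℕ) * h2


theorem prod_legendreSym_add_eq_of_odd {n c : ℕ} (hn : p = 2 * n + 1) (hc : n = 2 * c + 1) :
    ∏ j ∈ Icc 1 n, ∏ i ∈ Ico 1 j, legendreSym p ((j : ℤ) + 1 * (i : ℤ)) =
      ∏ j ∈ range n, legendreSym p (j.factorial : ℕ) := by
  have h := prod_legendreSym_add_mul (p := p) n
  rw [prod_range_eq_mid_of_reflect (f := fun j => legendreSym p ((2 * j + 1).factorial : ℕ)) hc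
    (fun j hj => legendreSym_factorial_odd_reflect hn hj)
    (fun j hj => legendreSym_factorial_sq (by omega)), ← hc, ← mul_assoc] at h
  have h0 := legendreSym_factorial_sq (p := p) (m := n) (by omega)
  have h1 : (∏ j ∈ range n, legendreSym p (j.factorial : ℕ)) ^ 2 = 1 := by
    rw [← prod_pow]
    exact prod_eq_one fun j hj => legendreSym_factorial_sq (by rw [mem_range] at hj; omega)
  generalize legendreSym p (n.factorial : ℕ) = x at *
  generalize ∏ j ∈ range n, legendreSym p (j.factorial : ℕ) = y at *
  generalize ∏ j ∈ Icc 1 n, ∏ i ∈ Ico 1 j, legendreSym p ((j : ℤ) + 1 * (i : ℤ)) = z at *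
  linear_combination x * y * h - (z * y ^ 2 - y) * h0 - z * h1

theorem prod_legendreSym_add_eq_of_even {n c : ℕ} (hn : p = 2 * n + 1) (hc : n = 2 * c) :
    ∏ j ∈ Icc 1 n, ∏ i ∈ Ico 1 j, legendreSym p ((j : ℤ) + 1 * (i : ℤ)) =
      (∏ j ∈ range n, legendreSym p (j.factorial : ℕ)) * legendreSym p (n.factorial : ℕ) := by
  have h := prod_legendreSym_add_mul (p := p) n
  rw [prod_range_eq_one_of_reflect (f := fun j => legendreSym p ((2 * j + 1).factorial : ℕ)) hc
    (fun j hj => legendreSym_factorial_odd_reflect hn hj)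
    (fun j hj => legendreSym_factorial_sq (by omega)), ← mul_assoc] at h
  have h0 := legendreSym_factorial_sq (p := p) (m := n) (by omega)
  have h1 : (∏ j ∈ range n, legendreSym p (j.factorial : ℕ)) ^ 2 = 1 := by
    rw [← prod_pow]
    exact prod_eq_one fun j hj => legendreSym_factorial_sq (by rw [mem_range] at hj; omega)
  generalize legendreSym p (n.factorial : ℕ) = x at *
  generalize ∏ j ∈ range n, legendreSym p (j.factorial : ℕ) = y at *
  generalize ∏ j ∈ Icc 1 n, ∏ i ∈ Ico 1 j, legendreSym p ((j : ℤ) + 1 * (i : ℤ)) = z at *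
  linear_combination x * y * h - z * y ^ 2 * h0 - z * h1

theorem legendreSym_factorial_eq_neg_one_pow {m : ℕ} (hm : m < p) :
    legendreSym p (m.factorial : ℕ) = (-1) ^ #{k ∈ Icc 1 m | legendreSym p (k : ℕ) = -1} := by
  rw [legendreSym_factorial]
  exact prod_eq_neg_one_pow_card_filter fun k hk =>
    legendreSym_eq_one_or_neg_one_of_mem (by simp at hk ⊢; omega)

theorem prod_range_legendreSym_factorial_of_three_mod_four {m : ℕ} (hm : p = 4 * m + 3) :
    ∏ j ∈ range (2 * m + 1), legendreSym p (j.factorial : ℕ) =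
      legendreSym p 2 ^ m * (-1) ^ #{k ∈ Icc 1 m | legendreSym p (k : ℕ) = -1} := by
  rw [prod_range_succ, prod_range_legendreSym_factorial (by omega),
    legendreSym_factorial_eq_neg_one_pow (by omega)]

theorem legendreSym_two_of_one_mod_four {m : ℕ} (hm : p = 4 * m + 1) :
    legendreSym p 2 = (-1) ^ m := by
  rw [legendreSym.at_two (by omega), ZMod.χ₈_nat_eq_if_mod_eight, if_neg (by omega)]
  split_ifs with h
  · rw [Even.neg_one_pow (by rw [Nat.even_iff]; omega)]
  · rw [Odd.neg_one_pow (by rw [Nat.odd_iff]; omega)]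

theorem legendreSym_factorial_half_of_one_mod_four {m : ℕ} (hm : p = 4 * m + 1) :
    legendreSym p ((2 * m).factorial : ℕ) = (-1) ^ m := by
  have h := ZMod.factorial_sq_mul_neg_one_pow (p := p) (n := 2 * m) (by omega)
  rw [Even.neg_one_pow (by simp), mul_one] at h
  have h1 := legendreSym.eq_pow p ((2 * m).factorial : ℕ)
  rw [Int.cast_natCast, show p / 2 = 2 * m by omega, pow_mul, h] at h1
  have h2 : (((-1) ^ m : ℤ) : ZMod p) = (-1) ^ m := by push_cast; rfl
  rw [← h2] at h1
  have hp2 : ((2 : ℕ) : ZMod p) ≠ 0 := by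
    rw [Ne, ZMod.natCast_eq_zero_iff]
    intro h
    have := Nat.le_of_dvd (by norm_num) h
    have := (Fact.out : p.Prime).two_le
    omega
  have h3 : legendreSym p ((2 * m).factorial : ℕ) = 1 ∨
      legendreSym p ((2 * m).factorial : ℕ) = -1 :=
    sq_eq_sq_iff_eq_or_eq_neg.mp ((legendreSym_factorial_sq (by omega)).trans (one_pow 2).symm)
  rcases h3 with h3 | h3 <;> rcases neg_one_pow_eq_or ℤ m with h4 | h4 <;>
    rw [h3, h4] at h1 ⊢ <;> exfalso <;> apply hp2 <;> push_cast at h1 ⊢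
  · linear_combination h1
  · linear_combination -h1

theorem prod_range_legendreSym_factorial_of_one_mod_four {m : ℕ} (hm : p = 4 * m + 1) :
    ∏ j ∈ range (2 * m), legendreSym p (j.factorial : ℕ) =
      (-1) ^ #{k ∈ Icc 1 m | legendreSym p (k : ℕ) = -1} := by
  have h := prod_range_legendreSym_factorial (p := p) (m := m) (by omega)
  rw [legendreSym_factorial_half_of_one_mod_four hm, legendreSym_two_of_one_mod_four hm,
    legendreSym_factorial_eq_neg_one_pow (by omega)] at h
  have h1 : ((-1 : ℤ) ^ m) ^ 2 = 1 := by rw [← pow_mul, Even.neg_one_pow (by simp)]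
  have h2 : ((-1 : ℤ) ^ m) ^ m = (-1) ^ m := by
    rcases Nat.even_or_odd m with hm | hm
    · simp [hm.neg_one_pow]
    · simp [hm.neg_one_pow]
  rw [h2] at h
  generalize ∏ j ∈ range (2 * m), legendreSym p (j.factorial : ℕ) = x at *
  linear_combination (-1) ^ m * h - (x - (-1) ^ #{k ∈ Icc 1 m | legendreSym p (k : ℕ) = -1}) * h1

theorem card_filter_legendreSym_add (m : ℕ) (hm : m < p) :
    #{k ∈ Icc 1 m | legendreSym p (k : ℕ) = 1} + #{k ∈ Icc 1 m | legendreSym p (k : ℕ) = -1} =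
      m := by
  rw [← card_union_of_disjoint, ← filter_or, filter_true_of_mem, Nat.card_Icc, Nat.add_sub_cancel]
  · exact fun k hk => legendreSym_eq_one_or_neg_one_of_mem (by simp at hk ⊢; omega)
  · rw [disjoint_filter]
    intro k _ h; rw [h]; norm_num

theorem two_mul_card_filter_legendreSym {m : ℕ} (hm : m < p) :
    ∑ k ∈ Icc 1 m, legendreSym p (k : ℕ) =
      m - 2 * #{k ∈ Icc 1 m | legendreSym p (k : ℕ) = -1} := by
  rw [sum_eq_card_sub_two_mul_card_filter fun k hk =>
    legendreSym_eq_one_or_neg_one_of_mem (by simp at hk ⊢; omega), Nat.card_Icc,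
    Nat.add_sub_cancel]

end

end

/-- Theorem 1.7, (1.21): let `p > 3` be a prime and `δ ∈ {1, -1}`. Then
`∏_{1 ≤ i < j ≤ (p-1)/2} ((j + δi)/p)` equals `(-1)^{#{0 < k < p/4 : (k/p) = δ}}` if
`p ≡ 1 (mod 4)`; `(-1)^{(p-3)/8}` if `p ≡ 3 (mod 8)`; and
`(-1)^{(p+1)/8 + (h(-p)+1)/2}` if `p ≡ 7 (mod 8)`, where `h(-p)` is the class number of
the imaginary quadratic field `ℚ(√-p)` (formalized as any number field `K = ℚ(α)` with
`α² = -p`). -/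
theorem statement18 (p : ℕ) [Fact p.Prime] (hp3 : 3 < p) (δ : ℤ) (hδ : δ = 1 ∨ δ = -1)
    (K : Type) [Field K] [NumberField K] (α : K) (hα : α ^ 2 = -(p : K))
    (hK : ∀ x : K, x ∈ Algebra.adjoin ℚ ({α} : Set K)) :
    (p % 4 = 1 →
      (∏ j ∈ Finset.Icc 1 ((p - 1) / 2), ∏ i ∈ Finset.Ico 1 j,
          legendreSym p ((j : ℤ) + δ * (i : ℤ)))
        = (-1) ^ ((Finset.Ico 1 p).filter
            (fun k => 4 * k < p ∧ legendreSym p (k : ℤ) = δ)).card) ∧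
    (p % 8 = 3 →
      (∏ j ∈ Finset.Icc 1 ((p - 1) / 2), ∏ i ∈ Finset.Ico 1 j,
          legendreSym p ((j : ℤ) + δ * (i : ℤ)))
        = (-1) ^ ((p - 3) / 8)) ∧
    (p % 8 = 7 →
      (∏ j ∈ Finset.Icc 1 ((p - 1) / 2), ∏ i ∈ Finset.Ico 1 j,
          legendreSym p ((j : ℤ) + δ * (i : ℤ)))
        = (-1) ^ ((p + 1) / 8 + (NumberField.classNumber K + 1) / 2)) := by
  have hprod {m : ℕ} (hm : p = 4 * m + 3) :
      (∏ j ∈ Finset.Icc 1 ((p - 1) / 2), ∏ i ∈ Finset.Ico 1 j,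
        legendreSym p ((j : ℤ) + δ * (i : ℤ))) =
      legendreSym p 2 ^ m *
        (-1) ^ (Finset.card {k ∈ Finset.Icc 1 m | legendreSym p (k : ℕ) = -1}) := by
    rw [← prod_range_legendreSym_factorial_of_three_mod_four hm,
      show (p - 1) / 2 = 2 * m + 1 by omega]
    rcases hδ with rfl | rfl
    · rw [prod_legendreSym_add_eq_of_odd (by omega) rfl]
    · rw [prod_legendreSym_sub]
  refine ⟨fun h4 => ?_, fun h8 => ?_, fun h8 => ?_⟩
  · obtain ⟨m, hm⟩ : ∃ m, p = 4 * m + 1 := ⟨p / 4, by omega⟩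
    have hfilter : (Finset.Ico 1 p).filter (fun k => 4 * k < p ∧ legendreSym p (k : ℤ) = δ) =
        (Finset.Icc 1 m).filter (fun k : ℕ => legendreSym p (k : ℤ) = δ) := by
      ext k
      simp only [Finset.mem_filter, Finset.mem_Ico, Finset.mem_Icc]
      constructor
      · rintro ⟨h1, h2, h3⟩
        exact ⟨by omega, h3⟩
      · rintro ⟨h1, h2⟩
        exact ⟨by omega, by omega, h2⟩
    rw [hfilter, show (p - 1) / 2 = 2 * m by omega]
    rcases hδ with rfl | rfl
    · rw [prod_legendreSym_add_eq_of_even (by omega) rfl,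
        prod_range_legendreSym_factorial_of_one_mod_four hm,
        legendreSym_factorial_half_of_one_mod_four hm, ← pow_add]
      have := card_filter_legendreSym_add (p := p) m (by omega)
      refine neg_one_pow_congr ?_
      rw [Nat.even_iff, Nat.even_iff]
      omega
    · rw [prod_legendreSym_sub, prod_range_legendreSym_factorial_of_one_mod_four hm]
  · obtain ⟨m, hm⟩ : ∃ m, p = 4 * m + 3 := ⟨p / 4, by omega⟩
    have hsum := two_mul_card_filter_legendreSym (p := p) (m := m) (by omega)
    rw [sum_legendreSym_quarter_of_three h8 hm] at hsum
    rw [hprod hm, legendreSym_two_of_three h8, ← pow_add]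
    refine neg_one_pow_congr ?_
    rw [Nat.even_iff, Nat.even_iff]
    omega
  · obtain ⟨m, hm⟩ : ∃ m, p = 4 * m + 3 := ⟨p / 4, by omega⟩
    have hsum := two_mul_card_filter_legendreSym (p := p) (m := m) (by omega)
    rw [sum_legendreSym_quarter_of_seven h8 hm,
      ← classNumber_eq_sum_legendreSym h8 (by omega) hα hK] at hsum
    rw [hprod hm, legendreSym_two_of_seven h8, one_pow, one_mul]
    refine neg_one_pow_congr ?_
    rw [Nat.even_iff, Nat.even_iff]
    omega
end

section
/- Let p be a prime with p ≡ 1 (mod 4). Then #{k : 1 ≤ k ≤ (p−1)/2 and {k·((p−1)/2)!}_p > p/2} = (p−1)/4. -/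
theorem ZMod.factorial_mul_factorial_sub_one_sub (p : ℕ) [Fact p.Prime] (k : ℕ) (hk : k < p) :
    ((k.factorial : ZMod p) * ((p - 1 - k).factorial : ZMod p)) = (-1) ^ (k + 1) := by
  induction k with
  | zero => simp [ZMod.wilsons_lemma]
  | succ k ih =>
    have h := ih (by omega)
    obtain ⟨j, hj⟩ : ∃ j, p = k + 2 + j := ⟨p - (k + 2), by omega⟩
    have hcast : (p : ZMod p) = k + 2 + j := by exact_mod_cast congrArg (Nat.cast (R := ZMod p)) hj
    rw [ZMod.natCast_self] at hcast
    rw [show p - 1 - k = j + 1 by omega, Nat.factorial_succ] at h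
    rw [show p - 1 - (k + 1) = j by omega, Nat.factorial_succ, pow_succ, ← h]
    push_cast
    linear_combination (-(k.factorial : ZMod p) * j.factorial) * hcast

theorem Nat.dvd_factorial_half_sq_add_one (p : ℕ) [Fact p.Prime] (hp : p % 4 = 1) :
    p ∣ ((p - 1) / 2).factorial * ((p - 1) / 2).factorial + 1 := by
  have h := ZMod.factorial_mul_factorial_sub_one_sub p ((p - 1) / 2) (by omega)
  rw [show p - 1 - (p - 1) / 2 = (p - 1) / 2 by omega,
    Odd.neg_one_pow (Nat.odd_iff.mpr (by omega))] at h
  rw [← ZMod.natCast_eq_zero_iff]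
  push_cast
  rw [h]
  ring

theorem Nat.mul_mod_mul_mod_of_dvd_sq_add_one {p a k : ℕ} (ha : p ∣ a * a + 1) (hk : 0 < k)
    (hkp : k < p) : k * a % p * a % p = p - k := by
  have h : p ∣ k * a % p * a % p + k := by
    rw [Nat.dvd_iff_mod_eq_zero, Nat.mod_mul_mod, Nat.mod_add_mod,
      show k * a * a + k = k * (a * a + 1) by ring]
    exact Nat.mod_eq_zero_of_dvd (ha.mul_left k)
  have hlt : k * a % p * a % p < p := Nat.mod_lt _ (by omega)
  have := Nat.eq_of_dvd_of_lt_two_mul (by omega) h (by omega)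
  omega

theorem Nat.sub_mul_mod_mul_mod_of_dvd_sq_add_one {p a k : ℕ} (ha : p ∣ a * a + 1) (hk : 0 < k)
    (hkp : k < p) : (p - k * a % p) * a % p = k := by
  have h := Nat.mul_mod_mul_mod_of_dvd_sq_add_one ha hk hkp
  have hlt : k * a % p < p := Nat.mod_lt _ (by omega)
  have hsum : (p - k * a % p) * a + k * a % p * a = p * a := by
    rw [← Nat.add_mul, Nat.sub_add_cancel hlt.le]
  have hmod : ((p - k * a % p) * a + k * a % p * a) % p = 0 := by simp [hsum]
  rw [Nat.add_mod, h] at hmod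
  have hlt' : (p - k * a % p) * a % p < p := Nat.mod_lt _ (by omega)
  have := Nat.eq_of_dvd_of_lt_two_mul (by omega) (Nat.dvd_of_mod_eq_zero hmod) (by omega)
  omega

theorem Nat.two_mul_card_filter_lt_two_mul_mod {p a : ℕ} (hp : Odd p) (ha : p ∣ a * a + 1) :
    2 * ((Finset.Icc 1 ((p - 1) / 2)).filter (fun k ↦ p < 2 * (k * a % p))).card
      = (p - 1) / 2 := by
  obtain ⟨m, hm⟩ := hp
  have hcard := Finset.card_filter_add_card_filter_not (s := Finset.Icc 1 ((p - 1) / 2))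
    (fun k ↦ p < 2 * (k * a % p))
  have hbij : ((Finset.Icc 1 ((p - 1) / 2)).filter (fun k ↦ p < 2 * (k * a % p))).card =
      ((Finset.Icc 1 ((p - 1) / 2)).filter (fun k ↦ ¬ p < 2 * (k * a % p))).card := by
    refine Finset.card_nbij' (fun k ↦ p - k * a % p) (fun k ↦ k * a % p) ?_ ?_ ?_ ?_ <;>
      intro k hk <;>
      simp only [Finset.coe_filter, Finset.mem_Icc, Set.mem_ofPred_eq] at hk ⊢ <;>
      have h1 := Nat.mul_mod_mul_mod_of_dvd_sq_add_one ha (k := k) (by omega) (by omega) <;>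
      have h2 := Nat.sub_mul_mod_mul_mod_of_dvd_sq_add_one ha (k := k) (by omega) (by omega) <;>
      have hlt : k * a % p < p := Nat.mod_lt _ (by omega)
    · omega
    · have hpos : k * a % p ≠ 0 := by
        intro h0
        simp only [h0, Nat.zero_mul, Nat.zero_mod] at h1
        omega
      omega
    · exact h2
    · omega
  rw [Nat.card_Icc] at hcard
  omega

/-- Lemma 3.3: let `p ≡ 1 (mod 4)` be a prime. Then
`#{1 ≤ k ≤ (p-1)/2 : {k·((p-1)/2)!}_p > p/2} = (p-1)/4`. -/
theorem statement19 (p : ℕ) [Fact p.Prime] (hp : p % 4 = 1) :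
    ((Finset.Icc 1 ((p - 1) / 2)).filter
        (fun k : ℕ =>
          (p : ℤ) < 2 * (((k : ℤ) * (Nat.factorial ((p - 1) / 2) : ℤ)) % (p : ℤ)))).card
      = (p - 1) / 4 := by
  have h := Nat.two_mul_card_filter_lt_two_mul_mod (Nat.odd_iff.mpr (by omega))
    (Nat.dvd_factorial_half_sq_add_one p hp)
  norm_cast
  omega
end
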